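/- Let p be an odd prime. Then the group C₄ × C_p × C_p is a DCI-group; that is, for all subsets S, T of G = C₄ × C_p × C_p, if the Cayley digraphs Cay(G,S) and Cay(G,T) are isomorphic as digraphs, then there exists φ ∈ Aut(G) with S^φ = T. -/

import Mathlib

open scoped Pointwise

noncomputable section

namespace Paper

/-- The element `∑_{x ∈ X} x` of the integer group ring `ℤG`. -/
def sumElems {G : Type*} [Group G] [Finite G] (X : Set G) : MonoidAlgebra ℤ G :=
  ∑ x ∈ X.toFinite.toFinset, MonoidAlgebra.single x (1 : ℤ)

/-- A Schur ring (S-ring) over a finite group `G`, described by the partition of `G`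
into its basic sets: the partition contains `{1}`, is closed under taking inverses,
and its `ℤ`-span inside the group ring `ℤG` is closed under multiplication
(hence is a subring of `ℤG`). -/
structure SRing (G : Type*) [Group G] [Finite G] where
  basic : Set (Set G)
  nonempty : ∀ X ∈ basic, X.Nonempty
  cover : ∀ g : G, ∃! X, X ∈ basic ∧ g ∈ X
  one_mem : ({1} : Set G) ∈ basic
  inv_mem : ∀ X ∈ basic, X⁻¹ ∈ basic
  mul_mem : ∀ a b : MonoidAlgebra ℤ G,
    a ∈ Submodule.span ℤ (sumElems '' basic) →
    b ∈ Submodule.span ℤ (sumElems '' basic) →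
    a * b ∈ Submodule.span ℤ (sumElems '' basic)

namespace SRing

/-- The `ℤ`-module underlying an S-ring. -/
def span {G : Type*} [Group G] [Finite G] (A : SRing G) :
    Submodule ℤ (MonoidAlgebra ℤ G) :=
  Submodule.span ℤ (sumElems '' A.basic)

/-- A set `X ⊆ G` is an `𝒜`-set if `∑_{x ∈ X} x ∈ 𝒜`. -/
def IsASet {G : Type*} [Group G] [Finite G] (A : SRing G) (X : Set G) : Prop :=
  sumElems X ∈ A.span

/-- A subgroup which is an `𝒜`-set is an `𝒜`-subgroup. -/
def IsASubgroup {G : Type*} [Group G] [Finite G] (A : SRing G) (H : Subgroup G) : Prop :=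
  A.IsASet (H : Set G)

end SRing

/-- The arc set `R(X) = {(g, xg) : x ∈ X, g ∈ G}` of the Cayley digraph `Cay(G, X)`. -/
def Rel {G : Type*} [Group G] (X : Set G) : Set (G × G) := {p | p.2 * p.1⁻¹ ∈ X}

/-- `f : G ≃ G'` is an isomorphism from the S-ring `A` over `G` to the S-ring `B`
over `G'` if `{R(X)^f : X ∈ 𝒮(A)} = {R(Y) : Y ∈ 𝒮(B)}`. -/
def IsSRingIso {G G' : Type*} [Group G] [Finite G] [Group G'] [Finite G']
    (A : SRing G) (B : SRing G') (f : G ≃ G') : Prop :=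
  (fun X => Prod.map f f '' Rel X) '' A.basic = Rel '' B.basic

/-- The automorphism group `Aut(𝒜)` of an S-ring, as a set of permutations of `G`. -/
def SRing.autSet {G : Type*} [Group G] [Finite G] (A : SRing G) : Set (Equiv.Perm G) :=
  {f | ∀ X ∈ A.basic, Prod.map f f '' Rel X = Rel X}

/-- The set `Iso(𝒜)` of isomorphisms from `𝒜` onto S-rings over the same group `G`. -/
def SRing.isoSet {G : Type*} [Group G] [Finite G] (A : SRing G) : Set (Equiv.Perm G) :=
  {f | ∃ B : SRing G, IsSRingIso A B f}

/-- `Aut(G)` as a set of permutations of `G`. -/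
def autPerm (G : Type*) [Group G] : Set (Equiv.Perm G) :=
  Set.range fun φ : G ≃* G => (φ.toEquiv : Equiv.Perm G)

/-- A CI-S-ring: `Aut(𝒜)·Aut(G) = Iso(𝒜)`. -/
def SRing.IsCI {G : Type*} [Group G] [Finite G] (A : SRing G) : Prop :=
  A.autSet * autPerm G = A.isoSet

/-- The orbits on `G` of a set of automorphisms of `G`. -/
def setOrbits {G : Type*} [Group G] (Δ : Set (MulAut G)) : Set (Set G) :=
  Set.range fun g : G => (fun φ : MulAut G => φ g) '' Δ

/-- An S-ring is cyclotomic if its basic sets are exactly the orbits of some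
subgroup `K ≤ Aut(G)`. -/
def SRing.IsCyclotomic {G : Type*} [Group G] [Finite G] (A : SRing G) : Prop :=
  ∃ K : Subgroup (MulAut G), A.basic = setOrbits (K : Set (MulAut G))

/-- `Aut_G(𝒜) = Aut(𝒜) ∩ Aut(G)`, as a set of automorphisms of `G`. -/
def SRing.autGSet {G : Type*} [Group G] [Finite G] (A : SRing G) : Set (MulAut G) :=
  {φ | (φ.toEquiv : Equiv.Perm G) ∈ A.autSet}

/-- A (cyclotomic) S-ring is Cayley minimal if `Aut_G(𝒜)` is the only subgroup of
`Aut(G)` whose orbits on `G` coincide with those of `Aut_G(𝒜)`. -/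
def SRing.IsCayleyMinimal {G : Type*} [Group G] [Finite G] (A : SRing G) : Prop :=
  ∀ K : Subgroup (MulAut G),
    setOrbits (K : Set (MulAut G)) = setOrbits A.autGSet →
    (K : Set (MulAut G)) = A.autGSet

/-- `rad(X) = {g ∈ G : gX = Xg = X}`. -/
def rad {G : Type*} [Group G] (X : Set G) : Set G := {g | {g} * X = X ∧ X * {g} = X}

/-- The class `𝓔_c` of finite abelian groups all of whose Sylow subgroups are
elementary abelian or isomorphic to `C₄`. -/
def InEc (G : Type*) [CommGroup G] [Finite G] : Prop :=
  ∀ p : ℕ, p.Prime → ∀ P : Sylow p G,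
    (∀ x : ↥(P : Subgroup G), x ^ p = 1) ∨
    Nonempty (↥(P : Subgroup G) ≃* Multiplicative (ZMod 4))

/-- A finite group `G` is a `DCI`-group if any two Cayley digraphs over `G` that are
isomorphic as digraphs are Cayley isomorphic. -/
def IsDCIGroup (G : Type*) [Group G] : Prop :=
  ∀ S T : Set G,
    (∃ f : G ≃ G, ∀ g h : G, h * g⁻¹ ∈ S ↔ f h * (f g)⁻¹ ∈ T) →
    ∃ φ : G ≃* G, ⇑φ '' S = T

/-- The subgroup `G_r ≤ Sym(G)` of right translations of `G`. -/
def rightTranslations (G : Type*) [Group G] : Subgroup (Equiv.Perm G) where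
  carrier := Set.range fun g : G => Equiv.mulRight g
  one_mem' := ⟨1, by ext x; simp⟩
  mul_mem' := by
    rintro _ _ ⟨a, rfl⟩ ⟨b, rfl⟩
    exact ⟨b * a, by ext x; simp [mul_assoc]⟩
  inv_mem' := by
    rintro _ ⟨a, rfl⟩
    exact ⟨a⁻¹, by ext x; simp⟩

/-- The basic sets of the S-ring `V(K, G)`: the orbits of the stabilizer `K_e`
of the identity on `G`. -/
def VBasic {G : Type*} [Group G] (K : Subgroup (Equiv.Perm G)) : Set (Set G) :=
  Set.range fun g : G => MulAction.orbit (MulAction.stabilizer K (1 : G)) g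

/-- A subgroup `R ≤ Sym(G)` is regular if for all `g, h ∈ G` there is a
unique `r ∈ R` with `r(g) = h`. -/
def IsRegularSubgroup {G : Type*} [Group G] (R : Subgroup (Equiv.Perm G)) : Prop :=
  ∀ g h : G, ∃! r : R, (r : Equiv.Perm G) g = h

/-- `K ∈ Sup(G_r)`. -/
def InSup {G : Type*} [Group G] (K : Subgroup (Equiv.Perm G)) : Prop :=
  rightTranslations G ≤ K

/-- `K ∈ Sup₂(G_r)`, i.e. `K ≥ G_r` and `K = K^{(2)} = Aut(V(K,G))`. -/
def InSup2 {G : Type*} [Group G] [Finite G] (K : Subgroup (Equiv.Perm G)) : Prop :=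
  InSup K ∧
    (K : Set (Equiv.Perm G)) =
      {f : Equiv.Perm G | ∀ X ∈ VBasic K, Prod.map (⇑f) (⇑f) '' Rel X = Rel X}

/-- `K₁ ⪯_G K₂`: `K₁ ≤ K₂` and every regular subgroup of `K₂` isomorphic to `G`
is conjugate in `K₂` to a subgroup of `K₁`. -/
def GComplete {G : Type*} [Group G] (K₁ K₂ : Subgroup (Equiv.Perm G)) : Prop :=
  K₁ ≤ K₂ ∧ ∀ R : Subgroup (Equiv.Perm G), R ≤ K₂ → IsRegularSubgroup R →
    Nonempty (↥R ≃* G) → ∃ k ∈ K₂, ∀ r ∈ R, k * r * k⁻¹ ∈ K₁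

/-- `K ∈ Sup₂^min(G_r)`: a minimal element of `Sup₂(G_r)` with respect to `⪯_G`. -/
def InSup2Min {G : Type*} [Group G] [Finite G] (K : Subgroup (Equiv.Perm G)) : Prop :=
  InSup2 K ∧ ∀ K' : Subgroup (Equiv.Perm G), InSup2 K' → GComplete K' K → K' = K

/-- The basic sets of the restriction `𝒜_U` of `𝒜` to an `𝒜`-subgroup `U`:
the basic sets of `𝒜` contained in `U`, viewed inside `U`. -/
def restrictBasic {G : Type*} [Group G] [Finite G] (A : SRing G) (U : Subgroup G) :
    Set (Set ↥U) :=
  {Y : Set ↥U | Subtype.val '' Y ∈ A.basic}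

/-- The basic sets of the quotient S-ring `𝒜_{G/L}`: the images of the basic
sets of `𝒜` under the canonical epimorphism `G → G/L`. -/
def quotBasic {G : Type*} [CommGroup G] [Finite G] (A : SRing G) (L : Subgroup G) :
    Set (Set (G ⧸ L)) :=
  (fun X => QuotientGroup.mk '' X) '' A.basic

/-- The basic sets of the S-ring `𝒜_S` on the section `S = U/L`: the images under
the canonical epimorphism `U → U/L` of the basic sets of `𝒜` contained in `U`. -/
def secBasic {G : Type*} [CommGroup G] [Finite G] (A : SRing G) (U L : Subgroup G) :
    Set (Set (↥U ⧸ L.subgroupOf U)) :=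
  {Z | ∃ X ∈ A.basic, X ⊆ (U : Set G) ∧
    Z = QuotientGroup.mk '' (Subtype.val ⁻¹' X : Set ↥U)}

/-- The set of bijections of `H ⧸ N` induced by members of `Δ ⊆ Sym(H)`
permuting the `N`-cosets. -/
def inducedOnQuot {H : Type*} [CommGroup H] (N : Subgroup H) (Δ : Set (Equiv.Perm H)) :
    Set (Equiv.Perm (H ⧸ N)) :=
  {σ | ∃ f ∈ Δ, ∀ x : H, σ (QuotientGroup.mk x) = QuotientGroup.mk (f x)}

/-- The canonical (injective) homomorphism `U/L → G/L` for `L ≤ U ≤ G`. -/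
def secIncl {G : Type*} [CommGroup G] (U L : Subgroup G) :
    (↥U ⧸ L.subgroupOf U) →* G ⧸ L :=
  QuotientGroup.map (L.subgroupOf U) L U.subtype (fun _ hx => hx)

/-- The set of bijections of the section `S = U/L` induced by members of
`Δ ⊆ Sym(G/L)` preserving `S` (i.e. permuting the `L`-cosets contained in `U`). -/
def inducedOnSec {G : Type*} [CommGroup G] (U L : Subgroup G)
    (Δ : Set (Equiv.Perm (G ⧸ L))) : Set (Equiv.Perm (↥U ⧸ L.subgroupOf U)) :=
  {σ | ∃ φ ∈ Δ, ∀ x : ↥U,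
    φ (QuotientGroup.mk (x : G) : G ⧸ L) = secIncl U L (σ (QuotientGroup.mk x))}

/-- The basic sets of the S-ring `(ℤL ⊗ 𝒜_V) ≀_{(V×L)/V} ℤ(U/V)` over `U`,
where `Lu, V ≤ U` and `𝒜_V` is the restriction of `𝒜_U` to `V`. -/
def tensorWreathBasic {U : Type*} [CommGroup U] [Finite U] (AU : SRing U)
    (Lu V : Subgroup U) : Set (Set U) :=
  {Z | (∃ l ∈ Lu, ∃ X ∈ AU.basic, X ⊆ (V : Set U) ∧ Z = l • X) ∨
       (∃ u : U, u ∉ Lu ⊔ V ∧ Z = u • (V : Set U))}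

/-- Condition (CA): `𝒜_S = ℤS`. -/
def CondCA {G : Type*} [CommGroup G] [Finite G] (A : SRing G) (U L : Subgroup G) : Prop :=
  ∀ AS : SRing (↥U ⧸ L.subgroupOf U), AS.basic = secBasic A U L →
    AS.basic = Set.range fun s => ({s} : Set (↥U ⧸ L.subgroupOf U))

/-- Condition (CA'): `𝒜_U` or `𝒜_{G/L}` is cyclotomic and `𝒜_S` is Cayley minimal. -/
def CondCA' {G : Type*} [CommGroup G] [Finite G] (A : SRing G) (U L : Subgroup G) : Prop :=
  ((∀ AU : SRing ↥U, AU.basic = restrictBasic A U → AU.IsCyclotomic) ∨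
   (∀ AQ : SRing (G ⧸ L), AQ.basic = quotBasic A L → AQ.IsCyclotomic)) ∧
  (∀ AS : SRing (↥U ⧸ L.subgroupOf U), AS.basic = secBasic A U L → AS.IsCayleyMinimal)

/-- Condition (CA''): `U ≅ C_{4p}`, `L ≅ C₂` and
`𝒜_U = (ℤL ⊗ 𝒜_V) ≀_{(V×L)/V} ℤ(U/V)` for an `𝒜_U`-subgroup `V` of order `p`. -/
def CondCA'' {G : Type*} [CommGroup G] [Finite G] (p : ℕ) (A : SRing G)
    (U L : Subgroup G) : Prop :=
  Nat.card ↥U = 4 * p ∧ IsCyclic ↥U ∧ Nat.card ↥L = 2 ∧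
  ∀ AU : SRing ↥U, AU.basic = restrictBasic A U →
    ∃ V : Subgroup ↥U, AU.IsASubgroup V ∧ Nat.card ↥V = p ∧
      AU.basic = tensorWreathBasic AU (L.subgroupOf U) V

/-- `𝒜 = 𝒜_{G₁} ⊗ 𝒜_{G₂}` for `G = G₁ × G₂` (internally). -/
def IsTensorDecomp {G : Type*} [CommGroup G] [Finite G] (A : SRing G)
    (G₁ G₂ : Subgroup G) : Prop :=
  A.IsASubgroup G₁ ∧ A.IsASubgroup G₂ ∧ G₁ ⊓ G₂ = ⊥ ∧ G₁ ⊔ G₂ = ⊤ ∧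
  A.basic = {Z | ∃ X ∈ A.basic, ∃ Y ∈ A.basic,
    X ⊆ (G₁ : Set G) ∧ Y ⊆ (G₂ : Set G) ∧ Z = X * Y}

/-- `𝒜` is the tensor product of two S-rings over proper nontrivial subgroups of `G`. -/
def TensorConclusion {G : Type*} [CommGroup G] [Finite G] (A : SRing G) : Prop :=
  ∃ G₁ G₂ : Subgroup G, G₁ ≠ ⊥ ∧ G₁ ≠ ⊤ ∧ G₂ ≠ ⊥ ∧ G₂ ≠ ⊤ ∧ IsTensorDecomp A G₁ G₂

/-- `𝒜` is a nontrivial `S = U/L`-wreath product satisfying one of the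
conditions (CA), (CA'), (CA''). -/
def WreathConclusion {G : Type*} [CommGroup G] [Finite G] (p : ℕ) (A : SRing G) : Prop :=
  ∃ U L : Subgroup G, L ≤ U ∧ A.IsASubgroup U ∧ A.IsASubgroup L ∧ L ≠ ⊥ ∧ U ≠ ⊤ ∧
    (∀ X ∈ A.basic, ¬ X ⊆ (U : Set G) → (L : Set G) ⊆ rad X) ∧
    (CondCA A U L ∨ CondCA' A U L ∨ CondCA'' p A U L)


open scoped commutatorElement

/-- Congruence modulo the periods of `s`. -/
def PerEq {V : Type*} [AddCommGroup V] (s : V → Prop) (a b : V) : Prop :=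
  ∀ v, s (a + v) ↔ s (b + v)

namespace PerEq

variable {V : Type*} [AddCommGroup V] {s : V → Prop} {a b c d : V}

theorem refl (s : V → Prop) (a : V) : PerEq s a a := fun _ => Iff.rfl

theorem symm (h : PerEq s a b) : PerEq s b a := fun v => (h v).symm

theorem trans (h : PerEq s a b) (h' : PerEq s b c) : PerEq s a c :=
  fun v => (h v).trans (h' v)

theorem iff (h : PerEq s a b) : s a ↔ s b := by simpa using h 0

theorem add_right (h : PerEq s a b) (c : V) : PerEq s (a + c) (b + c) := by
  intro v
  simpa [add_assoc] using h (c + v)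

theorem add_left (c : V) (h : PerEq s a b) : PerEq s (c + a) (c + b) := by
  simpa [add_comm] using h.add_right c

theorem add (h : PerEq s a b) (h' : PerEq s c d) : PerEq s (a + c) (b + d) :=
  (h.add_right c).trans (h'.add_left b)

theorem neg (h : PerEq s a b) : PerEq s (-a) (-b) := by
  have := (h.add_right (-a - b)).symm
  have e1 : a + (-a - b) = -b := by abel
  have e2 : b + (-a - b) = -a := by abel
  rwa [e1, e2] at this

theorem sub (h : PerEq s a b) (h' : PerEq s c d) : PerEq s (a - c) (b - d) := by
  rw [sub_eq_add_neg, sub_eq_add_neg]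
  exact h.add h'.neg

theorem nsmul (h : PerEq s a b) (n : ℕ) : PerEq s (n • a) (n • b) := by
  induction n with
  | zero => simpa using refl s 0
  | succ n ih => simpa [succ_nsmul] using ih.add h

/-- In a group of odd exponent, a multiple of four which is a period comes from a period. -/
theorem of_four_nsmul {p : ℕ} (hp : Odd p) (hV : ∀ v : V, p • v = 0)
    (h : PerEq s (4 • a) 0) : PerEq s a 0 := by
  obtain ⟨m, hm⟩ : ∃ m : ℕ, p ∣ 4 * m - 1 ∧ 1 ≤ 4 * m := by
    rcases Nat.odd_mod_four_iff.mp (Nat.odd_iff.mp hp) with h1 | h3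
    · exact ⟨3 * (p / 4) + 1, ⟨3, by omega⟩, by omega⟩
    · exact ⟨p / 4 + 1, ⟨1, by omega⟩, by omega⟩
  have e : m • (4 • a) = a := by
    obtain ⟨⟨r, hr⟩, h1⟩ := hm
    have : 4 * m = p * r + 1 := by omega
    rw [← mul_nsmul, this, add_nsmul, mul_nsmul, hV]
    simp
  have := h.nsmul m
  rwa [e, nsmul_zero] at this

end PerEq

/-- A family of actions, modulo periods of `s`, of a group `Q` on four copies of `V`
which preserves the relation `s (y - x)` between consecutive copies. -/
structure LevelAction {Q V : Type*} [Group Q] [AddCommGroup V] (s : V → Prop)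
    (k : ZMod 4 → Q → V → V) : Prop where
  mul : ∀ i q q' x, PerEq s (k i (q * q') x) (k i q (k i q' x))
  one : ∀ i x, PerEq s (k i 1 x) x
  rel : ∀ i q x y, s (k (i + 1) q y - k i q x) ↔ s (y - x)

/-- An isomorphism of relations which carries translations into a group acting in the same way
on each copy can be computed on a single copy. -/
theorem LevelAction.iso_zero {Q V : Type*} [AddCommGroup V] {s : V → Prop}
    {k : ZMod 4 → Q → V → V} {p : ℕ} (hp : Odd p) (hV : ∀ v : V, p • v = 0)
    (hk : ∀ i q x, PerEq s (k i q x) (k 0 q x)) {t : V → Prop} (b : ZMod 4 → V → V)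
    (hb0 : Function.Surjective (b 0)) (ρ : V → Q)
    (hρ : ∀ i u x, PerEq s (k i (ρ u) (b i x)) (b i (x + u)))
    (hst : ∀ i x y, s (b (i + 1) y - b i x) ↔ t (y - x)) (x y : V) :
    s (b 0 y - b 0 x) ↔ t (y - x) := by
  choose m hm using fun i => hb0 (b i 0)
  have hbm : ∀ i x, PerEq s (b i x) (b 0 (m i + x)) := by
    intro i x
    have h1 := hρ i x 0
    rw [zero_add] at h1
    refine h1.symm.trans ((hk i _ _).trans ?_)
    rw [← hm i]
    exact hρ 0 x (m i)
  have hB : ∀ i x y, s (b 0 y - b 0 x) ↔ t (m i - m (i + 1) + (y - x)) := by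
    intro i x y
    have h1 := ((hbm (i + 1) (y - m (i + 1))).sub (hbm i (x - m i))).iff
    rw [hst, add_sub_cancel, add_sub_cancel] at h1
    rw [← h1]
    congr! 1
    abel
  have hd : ∀ i, PerEq t (m i - m (i + 1)) (m 0 - m (0 + 1)) := by
    intro i v
    simpa using (hB i 0 v).symm.trans (hB 0 0 v)
  have h0 : PerEq t (m 0 - m (0 + 1)) 0 := by
    refine PerEq.of_four_nsmul hp hV ?_
    have h := (((hd 0).add (hd 1)).add (hd 2)).add (hd 3)
    have e : m 0 - m (0 + 1) + (m 1 - m (1 + 1)) + (m 2 - m (2 + 1)) + (m 3 - m (3 + 1)) = 0 := by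
      rw [show (0 + 1 : ZMod 4) = 1 from rfl, show (1 + 1 : ZMod 4) = 2 from rfl,
        show (2 + 1 : ZMod 4) = 3 from rfl, show (3 + 1 : ZMod 4) = 0 from rfl]
      abel
    rw [e] at h
    have h' := h.symm
    rwa [show ∀ a : V, a + a + a + a = 4 • a from fun a => by abel] at h'
  rw [hB 0 x y, h0 (y - x), zero_add]

namespace LevelAction

variable {Q V : Type*} [Group Q] [AddCommGroup V] {s : V → Prop} {k : ZMod 4 → Q → V → V}

theorem congr (H : LevelAction s k) {x x' : V} (i : ZMod 4) (q : Q) (h : PerEq s x x') :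
    PerEq s (k i q x) (k i q x') := by
  have key : ∀ v z, s (v - k i q z) ↔ s (k (i + 1) q⁻¹ v - z) := by
    intro v z
    rw [← H.rel i q z]
    refine PerEq.iff (PerEq.sub ?_ (PerEq.refl s _))
    have h1 := H.mul (i + 1) q q⁻¹ v
    rw [mul_inv_cancel] at h1
    exact (H.one _ v).symm.trans h1
  have h2 : PerEq s (-k i q x) (-k i q x') := by
    intro v
    rw [neg_add_eq_sub, neg_add_eq_sub, key, key]
    exact PerEq.iff ((PerEq.refl s _).sub h)
  simpa using h2.neg

theorem inv_apply (H : LevelAction s k) (i : ZMod 4) (q : Q) (x : V) :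
    PerEq s (k i q (k i q⁻¹ x)) x := by
  have h1 := H.mul i q q⁻¹ x
  rw [mul_inv_cancel] at h1
  exact h1.symm.trans (H.one i x)

theorem inj (H : LevelAction s k) {x x' : V} (i : ZMod 4) (q : Q)
    (h : PerEq s (k i q x) (k i q x')) : PerEq s x x' := by
  have key : ∀ z, PerEq s (k i q⁻¹ (k i q z)) z := by
    intro z
    simpa using H.inv_apply i q⁻¹ z
  exact (key x).symm.trans ((H.congr i q⁻¹ h).trans (key x'))

/-- If `Q` is nilpotent and contains the translations, it acts in the same way on each copy. -/
theorem levels_eq [Group.IsNilpotent Q] (H : LevelAction s k) {p : ℕ} (hp : Odd p)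
    (hV : ∀ v : V, p • v = 0) (τ : V → Q) (hτ : ∀ i u x, PerEq s (k i (τ u) x) (x + u))
    (i : ZMod 4) (q : Q) (x : V) : PerEq s (k i q x) (k (i + 1) q x) := by
  obtain ⟨n, hn⟩ :=
    Subgroup.nilpotent_iff_lowerCentralSeries.mp (inferInstance : Group.IsNilpotent Q)
  suffices h : ∀ j : ℕ, j ≤ n → ∀ q ∈ Subgroup.lowerCentralSeries (⊤ : Subgroup Q) (n - j), ∀ i x,
      PerEq s (k i q x) (k (i + 1) q x) by
    refine h n le_rfl q ?_ i x
    simp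
  intro j
  induction j with
  | zero =>
    intro _ q hq i x
    rw [Nat.sub_zero, hn, Subgroup.mem_bot] at hq
    subst hq
    exact (H.one i x).trans (H.one (i + 1) x).symm
  | succ j ih =>
    intro hj q hq
    have hc : ∀ u, ⁅q, τ u⁆ ∈ Subgroup.lowerCentralSeries (⊤ : Subgroup Q) (n - j) := by
      intro u
      rw [show n - j = n - (j + 1) + 1 by omega]
      exact Subgroup.commutator_mem_commutator hq (Subgroup.mem_top _)
    have hE : ∀ i x u, PerEq s (k i q (x + u)) (k i ⁅q, τ u⁆ (k i q x + u)) := by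
      intro i x u
      have h1 : q * τ u = ⁅q, τ u⁆ * (τ u * q) := by
        rw [commutatorElement_def]; group
      refine (H.congr i q (hτ i u x)).symm.trans ((H.mul i q (τ u) x).symm.trans ?_)
      rw [h1]
      refine (H.mul i _ _ x).trans (H.congr i _ ?_)
      exact (H.mul i _ _ x).trans (hτ i u _)
    set w : ZMod 4 → V := fun i => k (i + 1) q⁻¹ (k i q 0) with hw
    have hW1 : ∀ i a, PerEq s (k i q a) (k (i + 1) q (a + w i)) := by
      intro i a
      have h0 : PerEq s (k (i + 1) q (w i)) (k i q 0) := H.inv_apply (i + 1) q _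
      have h1 := hE (i + 1) (w i) a
      have h2 := (H.congr (i + 1) ⁅q, τ a⁆ (h0.add_right a))
      have h3 := (ih (by omega) _ (hc a) i (k i q 0 + a)).symm
      have h4 := (hE i 0 a).symm
      have h5 := (h1.trans (h2.trans (h3.trans h4))).symm
      rwa [zero_add, add_comm (w i)] at h5
    have hW2 : ∀ i x y, s (k (i + 1) q y - k (i + 1) q (x + w i)) ↔ s (y - x) := by
      intro i x y
      rw [← H.rel i q x y]
      exact ((PerEq.refl s _).sub (hW1 i x).symm).iff
    have hstep : ∀ i, PerEq s (w (i + 1)) (w i) := by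
      intro i v
      have h1 := hW2 i 0 (w i + v)
      have h2 := hW2 (i + 1) (w i) (w i + v + w (i + 1))
      have h3 := ((hW1 (i + 1) (w i + v)).sub (hW1 (i + 1) (w i))).iff
      rw [zero_add, h3, h2] at h1
      rw [show w i + v + w (i + 1) - w i = w (i + 1) + v by abel, sub_zero] at h1
      exact h1
    have hfour : ∀ i, PerEq s (w i) 0 := by
      intro i
      refine PerEq.of_four_nsmul hp hV ?_
      have a1 := hstep i
      have a2 := (hstep (i + 1)).trans a1
      have a3 := (hstep (i + 1 + 1)).trans a2
      have b1 := hW1 i 0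
      have b2 := hW1 (i + 1) (0 + w i)
      have b3 := hW1 (i + 1 + 1) (0 + w i + w (i + 1))
      have b4 := hW1 (i + 1 + 1 + 1) (0 + w i + w (i + 1) + w (i + 1 + 1))
      have e : i + 1 + 1 + 1 + 1 = i := by
        rw [add_assoc, add_assoc, add_assoc]
        exact add_eq_left.mpr (by decide)
      rw [e] at b4
      have h := H.inj i q (b1.trans (b2.trans (b3.trans b4)))
      have h' := (((((PerEq.refl s 0).add (PerEq.refl s (w i))).add a1).add a2).add a3).symm
      have := (h.trans h'.symm).symm
      rwa [show 0 + w i + w i + w i + w i = 4 • w i by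
        abel] at this
    intro i x
    have := (hW1 i x).trans (H.congr (i + 1) q ((hfour i).add_left x))
    rwa [add_zero] at this

theorem level_zero [Group.IsNilpotent Q] (H : LevelAction s k) {p : ℕ} (hp : Odd p)
    (hV : ∀ v : V, p • v = 0) (τ : V → Q) (hτ : ∀ i u x, PerEq s (k i (τ u) x) (x + u))
    (i : ZMod 4) (q : Q) (x : V) : PerEq s (k i q x) (k 0 q x) := by
  have h3 := H.levels_eq hp hV τ hτ 3 q x
  have h2 := (H.levels_eq hp hV τ hτ 2 q x).trans h3
  have h1 := (H.levels_eq hp hV τ hτ 1 q x).trans h2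
  fin_cases i
  · exact PerEq.refl s _
  · exact h1
  · exact h2
  · exact h3

theorem iso_apply [Group.IsNilpotent Q] (H : LevelAction s k) {p : ℕ} (hp : Odd p)
    (hV : ∀ v : V, p • v = 0) (τ : V → Q) (hτ : ∀ i u x, PerEq s (k i (τ u) x) (x + u))
    {t : V → Prop} (b : ZMod 4 → V → V) (hb0 : Function.Surjective (b 0)) (ρ : V → Q)
    (hρ : ∀ i u x, PerEq s (k i (ρ u) (b i x)) (b i (x + u)))
    (hst : ∀ i x y, s (b (i + 1) y - b i x) ↔ t (y - x)) (hb00 : b 0 0 = 0) {v v' : V} {q : Q}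
    (hq0 : k 0 q 0 = 0) (hqv : k 0 q v = b 0 v') : t v' ↔ s v := by
  have h1 := iso_zero hp hV (H.level_zero hp hV τ hτ) b hb0 ρ hρ hst 0 v'
  rw [sub_zero, hb00, ← hqv, ← hq0] at h1
  rw [← h1, ← (((H.levels_eq hp hV τ hτ 0 q v).symm).sub (PerEq.refl s (k 0 q 0))).iff, H.rel,
    sub_zero]

end LevelAction

section TransitivePGroup

theorem exists_addMonoidHom_section_of_module {p : ℕ} [Fact p.Prime] {V W : Type*}
    [AddCommGroup V] [AddCommGroup W] [Module (ZMod p) V] [Module (ZMod p) W] (f : V →+ W)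
    (hf : Function.Surjective f) : ∃ g : W →+ V, ∀ y, f (g y) = y := by
  obtain ⟨g, hg⟩ := Module.projective_lifting_property (f.toZModLinearMap p) LinearMap.id hf
  exact ⟨g.toAddMonoidHom, fun y => LinearMap.congr_fun hg y⟩

theorem exists_addMonoidHom_section {p : ℕ} [Fact p.Prime] {V W : Type*} [AddCommGroup V]
    [AddCommGroup W] (hV : ∀ v : V, p • v = 0) (f : V →+ W) (hf : Function.Surjective f) :
    ∃ g : W →+ V, ∀ y, f (g y) = y := by
  have hW : ∀ w : W, p • w = 0 := hf.forall.mpr fun v => by rw [← map_nsmul, hV, map_zero]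
  exact @exists_addMonoidHom_section_of_module p _ V W _ _ (AddCommGroup.zmodModule hV)
    (AddCommGroup.zmodModule hW) f hf

variable {V : Type*} [AddCommGroup V] {Q : Subgroup (Equiv.Perm V)}

/-- The vectors whose translation commutes with every element of `Q`. -/
def centralVectors (Q : Subgroup (Equiv.Perm V)) : AddSubgroup V where
  carrier := {z | ∀ q ∈ Q, ∀ x, q (x + z) = q x + z}
  zero_mem' := by simp
  add_mem' := by
    intro a c ha hc q hq x
    rw [← add_assoc, hc q hq, ha q hq, add_assoc]
  neg_mem' := by
    intro a ha q hq x
    have := ha q hq (x + -a)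
    rw [neg_add_cancel_right] at this
    rw [this, add_neg_cancel_right]

theorem mem_centralVectors {z : V} :
    z ∈ centralVectors Q ↔ ∀ q ∈ Q, ∀ x, q (x + z) = q x + z := Iff.rfl

theorem mem_centralVectors_of_fixed (hτ : ∀ u : V, Equiv.addRight u ∈ Q) {z : V}
    (hz : ∀ q ∈ Q, q 0 = 0 → q z = z) : z ∈ centralVectors Q := by
  intro q hq x
  have h := hz (Equiv.addRight (-(q x)) * q * Equiv.addRight x)
    (mul_mem (mul_mem (hτ _) hq) (hτ _)) (by simp)
  simp only [Equiv.Perm.mul_apply, Equiv.coe_addRight] at h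
  rw [add_comm x z, add_comm (q x), ← sub_eq_iff_eq_add, sub_eq_add_neg]
  exact h

variable [Finite V] {p : ℕ} [Fact p.Prime]

theorem dvd_card_centralVectors (hQ : IsPGroup p Q) (hcard : Nat.card V = p ^ 2)
    (hτ : ∀ u : V, Equiv.addRight u ∈ Q) : p ∣ Nat.card (centralVectors Q) := by
  have h0 : IsPGroup p (Q ⊓ MulAction.stabilizer (Equiv.Perm V) (0 : V) : Subgroup _) :=
    hQ.to_le inf_le_left
  have h1 := h0.card_modEq_card_fixedPoints V
  have h2 : MulAction.fixedPoints
      (Q ⊓ MulAction.stabilizer (Equiv.Perm V) (0 : V) : Subgroup _) V = centralVectors Q := by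
    ext z
    constructor
    · intro hz
      refine mem_centralVectors_of_fixed hτ fun q hq hq0 => ?_
      exact hz ⟨q, hq, hq0⟩
    · rintro hz ⟨q, hq, hq0⟩
      have := mem_centralVectors.mp hz q hq 0
      rw [zero_add, show q 0 = 0 from hq0, zero_add] at this
      exact this
  rw [h2, hcard] at h1
  have h3 : p ^ 2 ≡ 0 [MOD p] := (Nat.modEq_zero_iff_dvd.mpr (dvd_pow_self p two_ne_zero))
  exact Nat.modEq_zero_iff_dvd.mp (h1.symm.trans h3)

theorem card_quotient_centralVectors (hQ : IsPGroup p Q) (hcard : Nat.card V = p ^ 2)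
    (hτ : ∀ u : V, Equiv.addRight u ∈ Q) :
    Nat.card (V ⧸ centralVectors Q) = 1 ∨
      Nat.card (V ⧸ centralVectors Q) = p ∧ Nat.card (centralVectors Q) = p := by
  have hp : p.Prime := Fact.out
  obtain ⟨c, hc⟩ := dvd_card_centralVectors hQ hcard hτ
  have h := (centralVectors Q).card_eq_card_quotient_mul_card_addSubgroup
  rw [hcard, hc] at h
  have h' : p = Nat.card (V ⧸ centralVectors Q) * c := by
    apply Nat.eq_of_mul_eq_mul_left hp.pos
    rw [← sq, h]; ring
  rcases (Nat.dvd_prime hp).mp ⟨c, h'⟩ with h1 | h1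
  · exact Or.inl h1
  · refine Or.inr ⟨h1, ?_⟩
    rw [h1] at h'
    have : c = 1 := Nat.eq_of_mul_eq_mul_left hp.pos (by rw [← h', mul_one])
    rw [hc, this, mul_one]

theorem sub_mem_centralVectors (hQ : IsPGroup p Q) (hcard : Nat.card V = p ^ 2)
    (hτ : ∀ u : V, Equiv.addRight u ∈ Q) {q : Equiv.Perm V} (hq : q ∈ Q) (x : V) :
    q x - (x + q 0) ∈ centralVectors Q := by
  suffices h : ∀ q ∈ Q, q 0 = 0 → ∀ x, q x - x ∈ centralVectors Q by
    have := h (Equiv.addRight (-(q 0)) * q) (mul_mem (hτ _) hq) (by simp) x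
    simp only [Equiv.Perm.mul_apply, Equiv.coe_addRight] at this
    convert this using 1
    abel
  set Q₀ : Subgroup (Equiv.Perm V) := Q ⊓ MulAction.stabilizer (Equiv.Perm V) (0 : V) with hQ₀
  let _ : MulAction Q₀ (V ⧸ centralVectors Q) :=
    { smul := fun q => Quotient.map' (fun x => q.1 x) (by
        intro x y hxy
        rw [QuotientAddGroup.leftRel_apply] at hxy ⊢
        have := mem_centralVectors.mp hxy q.1 q.2.1 x
        rw [add_neg_cancel_left] at this
        rw [this, neg_add_cancel_left]
        exact hxy)
      one_smul := by
        intro x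
        induction x using Quotient.inductionOn'
        rfl
      mul_smul := by
        intro a c x
        induction x using Quotient.inductionOn'
        rfl }
  have hfix : ∀ y : V ⧸ centralVectors Q, y ∈ MulAction.fixedPoints Q₀ (V ⧸ centralVectors Q) := by
    have h0 : (0 : V ⧸ centralVectors Q) ∈ MulAction.fixedPoints Q₀ (V ⧸ centralVectors Q) := by
      intro q
      exact congrArg (QuotientAddGroup.mk (s := centralVectors Q)) (show q.1 0 = 0 from q.2.2)
    rcases card_quotient_centralVectors hQ hcard hτ with h1 | ⟨h1, -⟩
    · have := (Nat.card_eq_one_iff_unique.mp h1).1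
      intro y
      rwa [Subsingleton.elim y 0]
    · have hp : IsPGroup p Q₀ := hQ.to_le inf_le_left
      have h2 := hp.card_modEq_card_fixedPoints (V ⧸ centralVectors Q)
      rw [h1] at h2
      have h3 : p ∣ Nat.card (MulAction.fixedPoints Q₀ (V ⧸ centralVectors Q)) :=
        (Nat.modEq_zero_iff_dvd.mp (h2.symm.trans (Nat.modEq_zero_iff_dvd.mpr dvd_rfl)))
      have h4 : 0 < Nat.card (MulAction.fixedPoints Q₀ (V ⧸ centralVectors Q)) :=
        Nat.card_pos_iff.mpr ⟨⟨⟨0, h0⟩⟩, inferInstance⟩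
      have h5 := Nat.le_of_dvd h4 h3
      have h6 : MulAction.fixedPoints Q₀ (V ⧸ centralVectors Q) = Set.univ := by
        apply Set.eq_of_subset_of_ncard_le (Set.subset_univ _)
        rw [Set.ncard_univ, h1]
        exact h5
      intro y
      rw [h6]
      trivial
  intro q hq hq0 x
  have h := hfix (QuotientAddGroup.mk x) ⟨q, hq, hq0⟩
  have h' : (QuotientAddGroup.mk (q x) : V ⧸ centralVectors Q) = QuotientAddGroup.mk x := h
  exact (QuotientAddGroup.eq_iff_sub_mem).mp h'

/-- The stabilizer of `0` in a transitive `p`-group moves every non-central vector to any other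
vector in its coset. -/
theorem exists_apply_eq_of_sub_mem (hQ : IsPGroup p Q) (hcard : Nat.card V = p ^ 2)
    (hτ : ∀ u : V, Equiv.addRight u ∈ Q) {v w : V} (hv : v ∉ centralVectors Q)
    (hw : w - v ∈ centralVectors Q) : ∃ q ∈ Q, q 0 = 0 ∧ q v = w := by
  have hp : p.Prime := Fact.out
  set Q₀ : Subgroup (Equiv.Perm V) := Q ⊓ MulAction.stabilizer (Equiv.Perm V) (0 : V) with hQ₀
  have hcF : Nat.card (centralVectors Q) = p := by
    rcases card_quotient_centralVectors hQ hcard hτ with h1 | ⟨-, h1⟩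
    · exfalso
      have := (Nat.card_eq_one_iff_unique.mp h1).1
      apply hv
      rw [← QuotientAddGroup.eq_zero_iff]
      exact Subsingleton.elim _ _
    · exact h1
  have hp₀ : IsPGroup p Q₀ := hQ.to_le inf_le_left
  obtain ⟨n, hn⟩ := hp₀.card_orbit v
  have hsub : MulAction.orbit Q₀ v ⊆ (fun z => z + v) '' (centralVectors Q : Set V) := by
    rintro _ ⟨⟨q, hq, hq0⟩, rfl⟩
    have := sub_mem_centralVectors hQ hcard hτ hq v
    rw [show q 0 = 0 from hq0, add_zero] at this
    exact ⟨_, this, sub_add_cancel _ _⟩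
  have hn0 : n ≠ 0 := by
    rintro rfl
    apply hv
    refine mem_centralVectors_of_fixed hτ fun q hq hq0 => ?_
    rw [pow_zero] at hn
    have := (Nat.card_eq_one_iff_unique.mp hn).1
    have h := Subsingleton.elim (⟨v, MulAction.mem_orbit_self v⟩ : MulAction.orbit Q₀ v)
      ⟨_, MulAction.mem_orbit v (⟨q, hq, hq0⟩ : Q₀)⟩
    exact (congrArg Subtype.val h).symm
  have heq : MulAction.orbit Q₀ v = (fun z => z + v) '' (centralVectors Q : Set V) := by
    apply Set.eq_of_subset_of_ncard_le hsub
    rw [Set.ncard_image_of_injective _ (add_left_injective v)]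
    change Nat.card (centralVectors Q) ≤ Nat.card (MulAction.orbit Q₀ v)
    rw [hcF, hn]
    exact Nat.le_self_pow hn0 p
  have hmem : w ∈ MulAction.orbit Q₀ v := by
    rw [heq]
    exact ⟨_, hw, sub_add_cancel _ _⟩
  obtain ⟨⟨q, hq, hq0⟩, h⟩ := hmem
  exact ⟨q, hq, hq0, h⟩

/-- If a bijection carries the translations of a group of order `p ^ 2` and exponent `p` into a
`p`-group `Q` containing the translations, then on each vector it agrees up to `Q` with a fixed
automorphism. -/
theorem exists_addEquiv_of_conj_mem (hQ : IsPGroup p Q) (hcard : Nat.card V = p ^ 2)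
    (hV : ∀ v : V, p • v = 0) (hτ : ∀ u : V, Equiv.addRight u ∈ Q) (b : Equiv.Perm V)
    (hb0 : b 0 = 0) (hb : ∀ u : V, b * Equiv.addRight u * b⁻¹ ∈ Q) :
    ∃ φ : V ≃+ V, ∀ v, ∃ q ∈ Q, q 0 = 0 ∧ q v = b (φ v) := by
  set F := centralVectors Q with hF
  have hinv : ∀ x, (b⁻¹ : Equiv.Perm V) (b x) = x := b.symm_apply_apply
  have hinv' : ∀ x, b ((b⁻¹ : Equiv.Perm V) x) = x := b.apply_symm_apply
  have hadd : ∀ z ∈ F, ∀ u, b (b⁻¹ z + u) = b u + z := by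
    intro z hz u
    have h1 := mem_centralVectors.mp hz _ (hb u) 0
    have h2 : (b⁻¹ : Equiv.Perm V) 0 = 0 := by rw [Equiv.Perm.inv_eq_iff_eq, hb0]
    simp only [Equiv.Perm.mul_apply, Equiv.coe_addRight, h2, zero_add] at h1
    exact h1
  let ι : F →+ V := AddMonoidHom.mk' (fun z => b⁻¹ (z : V)) (by
    rintro ⟨y, hy⟩ ⟨z, hz⟩
    have := hadd y hy ((b⁻¹ : Equiv.Perm V) z)
    rw [hinv', add_comm z] at this
    change (b⁻¹ : Equiv.Perm V) (y + z) = _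
    rw [← this, hinv])
  let π : V →+ V ⧸ F := QuotientAddGroup.mk' F
  let ℓ : V →+ V ⧸ F := AddMonoidHom.mk' (fun u => π (b u)) (by
    intro x u
    have h := sub_mem_centralVectors hQ hcard hτ (hb u) (b x)
    have h2 : (b⁻¹ : Equiv.Perm V) 0 = 0 := by rw [Equiv.Perm.inv_eq_iff_eq, hb0]
    simp only [Equiv.Perm.mul_apply, hinv, Equiv.coe_addRight, h2,
      zero_add] at h
    rw [← map_add]
    exact QuotientAddGroup.eq_iff_sub_mem.mpr h)
  have hℓ : Function.Surjective ℓ := by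
    intro y
    obtain ⟨v, rfl⟩ := QuotientAddGroup.mk'_surjective F y
    exact ⟨(b⁻¹ : Equiv.Perm V) v, by simp only [ℓ, AddMonoidHom.mk'_apply, hinv']; rfl⟩
  obtain ⟨σ, hσ⟩ := exists_addMonoidHom_section hV π (QuotientAddGroup.mk'_surjective F)
  obtain ⟨σ', hσ'⟩ := exists_addMonoidHom_section hV ℓ hℓ
  have hker : ∀ v, π v = 0 ↔ v ∈ F := fun v => QuotientAddGroup.eq_zero_iff v
  let κ : V →+ F := AddMonoidHom.mk' (fun v => ⟨v - σ (π v), by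
    rw [← hker, map_sub, hσ, sub_self]⟩) (by
    intro x y
    ext
    simp only [map_add, AddSubgroup.coe_add]
    exact add_sub_add_comm _ _ _ _)
  let φ : V →+ V := ι.comp κ + σ'.comp π
  have hφ : ∀ v, φ v = ι (κ v) + σ' (π v) := fun v => rfl
  have hℓι : ∀ z, ℓ (ι z) = 0 := by
    intro z
    simp only [ℓ, ι, AddMonoidHom.mk'_apply, hinv', hker, z.2]
  have hℓφ : ∀ v, ℓ (φ v) = π v := by
    intro v
    rw [hφ, map_add, hℓι, hσ', zero_add]
  have hφF : ∀ v ∈ F, b (φ v) = v := by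
    intro v hv
    have hv' := (hker v).mpr hv
    simp [hφ, κ, ι, hv']
  have hinj : Function.Injective φ := by
    rw [injective_iff_map_eq_zero]
    intro v hv
    have h1 : π v = 0 := by rw [← hℓφ, hv, map_zero]
    rw [← hφF v ((hker v).mp h1), hv, hb0]
  refine ⟨AddEquiv.ofBijective φ (Finite.injective_iff_bijective.mp hinj), fun v => ?_⟩
  change ∃ q ∈ Q, q 0 = 0 ∧ q v = b (φ v)
  by_cases hv : v ∈ F
  · exact ⟨1, one_mem _, rfl, by rw [hφF v hv]; rfl⟩
  · exact exists_apply_eq_of_sub_mem hQ hcard hτ hv (QuotientAddGroup.eq_iff_sub_mem.mp (hℓφ v))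

end TransitivePGroup

section CayleyIso

variable {G : Type*} [AddCommGroup G]

/-- `b` is an isomorphism from the Cayley digraph of `T` to the Cayley digraph of `S`. -/
def IsCayleyIso (S T : G → Prop) (b : Equiv.Perm G) : Prop :=
  ∀ g h, S (b h - b g) ↔ T (h - g)

/-- The automorphism group of the Cayley digraph of `S`. -/
def cayleyAut (S : G → Prop) : Subgroup (Equiv.Perm G) where
  carrier := {α | IsCayleyIso S S α}
  one_mem' := fun _ _ => Iff.rfl
  mul_mem' := fun ha hc g h => (ha _ _).trans (hc g h)
  inv_mem' := by
    intro a ha g h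
    have := ha (a.symm g) (a.symm h)
    rw [a.apply_symm_apply, a.apply_symm_apply] at this
    exact this.symm

theorem addRight_mem_cayleyAut (S : G → Prop) (g : G) : Equiv.addRight g ∈ cayleyAut S := by
  intro x y
  simp

namespace IsCayleyIso

variable {S T U : G → Prop} {a b : Equiv.Perm G}

theorem mul (ha : IsCayleyIso S T a) (hb : IsCayleyIso T U b) : IsCayleyIso S U (a * b) :=
  fun g h => (ha _ _).trans (hb g h)

theorem inv (hb : IsCayleyIso S T b) : IsCayleyIso T S b⁻¹ := by
  intro g h
  have := hb (b.symm g) (b.symm h)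
  rw [b.apply_symm_apply, b.apply_symm_apply] at this
  exact this.symm

theorem conj_mem (hb : IsCayleyIso S T b) (ha : a ∈ cayleyAut T) :
    b * a * b⁻¹ ∈ cayleyAut S :=
  (hb.mul ha).mul hb.inv

end IsCayleyIso

end CayleyIso

theorem exists_conj_mem_pGroup {A : Type*} [Group A] [Finite A] {p : ℕ} [Fact p.Prime]
    {K P P' : Subgroup A} (hP : IsPGroup p P) (hP' : IsPGroup p P') (hPK : P ≤ K) (hPK' : P' ≤ K) :
    ∃ Q ≤ K, IsPGroup p Q ∧ P ≤ Q ∧ ∃ a ∈ K, ∀ x ∈ P', a * x * a⁻¹ ∈ Q := by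
  obtain ⟨Q, hQ⟩ := (hP.comap_subtype (K := K)).exists_le_sylow
  obtain ⟨Q', hQ'⟩ := (hP'.comap_subtype (K := K)).exists_le_sylow
  obtain ⟨a, ha⟩ := MulAction.exists_smul_eq K Q' Q
  refine ⟨(Q : Subgroup K).map K.subtype, ?_, Q.2.map _, ?_, a, a.2, ?_⟩
  · rintro _ ⟨x, -, rfl⟩
    exact x.2
  · intro x hx
    exact ⟨⟨x, hPK hx⟩, hQ hx, rfl⟩
  · intro x hx
    refine ⟨a * ⟨x, hPK' hx⟩ * a⁻¹, ?_, rfl⟩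
    rw [← ha]
    exact Subgroup.smul_mem_pointwise_smul _ (MulAut.conj a) _ (hQ' hx)

section Product

variable {V : Type*} [AddCommGroup V]

/-- Translation by a vector of the second factor. -/
def sndTranslation : Multiplicative V →* Equiv.Perm (ZMod 4 × V) where
  toFun u := Equiv.addRight (0, u.toAdd)
  map_one' := by
    ext1 x
    simp [← Prod.zero_eq_mk]
  map_mul' u v := by
    ext1 x
    simp [add_left_comm, add_comm]

theorem sndTranslation_apply (u : V) (x : ZMod 4 × V) :
    sndTranslation (Multiplicative.ofAdd u) x = (x.1, x.2 + u) := by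
  simp [sndTranslation, Prod.ext_iff]

theorem isPGroup_range_sndTranslation {p : ℕ} (hV : ∀ v : V, p • v = 0) :
    IsPGroup p (sndTranslation (V := V)).range := by
  have h : IsPGroup p (Multiplicative V) := fun u => ⟨1, by
    rw [pow_one]; exact hV u.toAdd⟩
  exact h.of_surjective _ (sndTranslation (V := V)).rangeRestrict_surjective

variable [Finite V] {p : ℕ} [Fact p.Prime]

theorem exists_pGroup_of_conj_mem (hV : ∀ v : V, p • v = 0)
    {K : Subgroup (Equiv.Perm (ZMod 4 × V))} (b : Equiv.Perm (ZMod 4 × V))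
    (hK : ∀ u, sndTranslation u ∈ K) (hbK : ∀ u, b * sndTranslation u * b⁻¹ ∈ K) :
    ∃ Q ≤ K, IsPGroup p Q ∧ (∀ u, sndTranslation u ∈ Q) ∧
      ∃ a ∈ K, ∀ u, (a * b) * sndTranslation u * (a * b)⁻¹ ∈ Q := by
  have hP := isPGroup_range_sndTranslation hV
  obtain ⟨Q, hQK, hQ, hPQ, a, ha, haQ⟩ := exists_conj_mem_pGroup (K := K) hP
    (hP.map (MulAut.conj b).toMonoidHom) (by rintro _ ⟨u, rfl⟩; exact hK u)
    (by rintro _ ⟨_, ⟨u, rfl⟩, rfl⟩; exact hbK u)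
  refine ⟨Q, hQK, hQ, fun u => hPQ ⟨u, rfl⟩, a, ha, fun u => ?_⟩
  have := haQ _ ⟨_, ⟨u, rfl⟩, rfl⟩
  simpa [mul_assoc] using this

theorem exists_addEquiv_of_preserves_zero {Q : Subgroup (Equiv.Perm (ZMod 4 × V))}
    (hQ : IsPGroup p Q) (hcard : Nat.card V = p ^ 2) (hV : ∀ v : V, p • v = 0)
    (hQ0 : ∀ q ∈ Q, ∀ v, (q (0, v)).1 = 0) (hτ : ∀ u, sndTranslation u ∈ Q)
    {b : Equiv.Perm (ZMod 4 × V)} (hb1 : ∀ v, (b (0, v)).1 = 0) (hb0 : b 0 = 0)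
    (hb : ∀ u, b * sndTranslation u * b⁻¹ ∈ Q) :
    ∃ φ : V ≃+ V, ∀ v, ∃ q ∈ Q, q 0 = 0 ∧ q (0, v) = b (0, φ v) := by
  let r : Q →* Equiv.Perm V := MonoidHom.toHomPerm
    { toFun := fun q v => (q.1 (0, v)).2
      map_one' := rfl
      map_mul' := by
        intro q q'
        funext v
        change (q.1 (q'.1 (0, v))).2 = (q.1 (0, (q'.1 (0, v)).2)).2
        congr 2
        exact Prod.ext (hQ0 _ q'.2 v) rfl }
  have hr : ∀ q v, q.1 (0, v) = (0, r q v) := fun q v => Prod.ext (hQ0 _ q.2 v) rfl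
  let b₀ : Equiv.Perm V := Equiv.ofBijective (fun v => (b (0, v)).2) (by
    refine Finite.injective_iff_bijective.mp fun v w hvw => ?_
    have := b.injective (Prod.ext ((hb1 v).trans (hb1 w).symm) hvw)
    exact congrArg Prod.snd this)
  have hb₀ : ∀ v, b (0, v) = (0, b₀ v) := fun v => Prod.ext (hb1 v) rfl
  have hrange : IsPGroup p r.range := hQ.of_surjective _ r.rangeRestrict_surjective
  obtain ⟨φ, hφ⟩ := exists_addEquiv_of_conj_mem hrange hcard hV
    (fun u => ⟨⟨_, hτ (Multiplicative.ofAdd u)⟩, by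
      ext1 v
      have := hr ⟨_, hτ (Multiplicative.ofAdd u)⟩ v
      rw [sndTranslation_apply] at this
      exact (congrArg Prod.snd this).symm⟩) b₀
    (congrArg Prod.snd hb0) (fun u => ⟨⟨_, hb (Multiplicative.ofAdd u)⟩, by
      rw [eq_mul_inv_iff_mul_eq]
      ext1 v
      have h1 := hr ⟨_, hb (Multiplicative.ofAdd u)⟩ (b₀ v)
      rw [← hb₀] at h1
      simp only [Equiv.Perm.mul_apply] at h1
      rw [show (b⁻¹ : Equiv.Perm _) (b (0, v)) = (0, v) from b.symm_apply_apply _,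
        sndTranslation_apply, hb₀] at h1
      exact (congrArg Prod.snd h1).symm⟩)
  refine ⟨φ, fun v => ?_⟩
  obtain ⟨_, ⟨q, rfl⟩, hq0, hqv⟩ := hφ v
  refine ⟨q, q.2, ?_, ?_⟩
  · exact (hr q 0).trans (by rw [hq0]; rfl)
  · rw [hr, hb₀, hqv]

end Product

theorem mul_addRight_conj_sndTranslation {V : Type*} [AddCommGroup V]
    (a : Equiv.Perm (ZMod 4 × V)) (g : ZMod 4 × V) (u : Multiplicative V) :
    a * Equiv.addRight g * sndTranslation u * (a * Equiv.addRight g)⁻¹ =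
      a * sndTranslation u * a⁻¹ := by
  have hcomm : Equiv.addRight g * sndTranslation u = sndTranslation u * Equiv.addRight g := by
    ext1 x
    simp [sndTranslation, add_right_comm]
  rw [mul_inv_rev, mul_assoc a, hcomm, ← mul_assoc, ← mul_assoc, mul_assoc _ (Equiv.addRight g),
    mul_inv_cancel, mul_one]

/-- The permutations which preserve the first coordinate. -/
def fstStabilizer (V : Type*) : Subgroup (Equiv.Perm (ZMod 4 × V)) where
  carrier := {a | ∀ g, (a g).1 = g.1}
  one_mem' := fun _ => rfl
  mul_mem' := fun ha hc g => (ha _).trans (hc g)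
  inv_mem' := by
    intro a ha g
    have := ha (a.symm g)
    rw [a.apply_symm_apply] at this
    exact this.symm

section PreservesFst

variable {V : Type*} [AddCommGroup V] {S T : ZMod 4 × V → Prop} {b : Equiv.Perm (ZMod 4 × V)}

theorem levelAction_of_preserves_fst {Q : Subgroup (Equiv.Perm (ZMod 4 × V))}
    (hQS : Q ≤ cayleyAut S) (hQ1 : ∀ q ∈ Q, ∀ g, (q g).1 = g.1) (d : ZMod 4) :
    LevelAction (fun x => S (d, x)) fun i (q : Q) x => (q.1 (i * d, x)).2 where
  mul i q q' x := by
    have h : q'.1 (i * d, x) = (i * d, (q'.1 (i * d, x)).2) := Prod.ext (hQ1 _ q'.2 _) rfl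
    have e : ((q * q').1 (i * d, x)).2 = (q.1 (i * d, (q'.1 (i * d, x)).2)).2 :=
      congrArg (fun z => (q.1 z).2) h
    rw [e]
    exact PerEq.refl _ _
  one i x := PerEq.refl _ _
  rel i q x y := by
    have hk : ∀ i x, q.1 (i * d, x) = (i * d, (q.1 (i * d, x)).2) := fun i x =>
      Prod.ext (hQ1 _ q.2 _) rfl
    have hd : ∀ x y : V, (d, y - x) = ((i + 1) * d, y) - (i * d, x) := fun x y => by
      rw [Prod.mk_sub_mk, add_mul, one_mul, add_sub_cancel_left]
    change S (d, _) ↔ S (d, _)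
    rw [hd, hd, ← hk, ← hk]
    exact hQS q.2 _ _

variable [Finite V] {p : ℕ} [Fact p.Prime]

theorem iff_of_preserves_fst (hp : Odd p) (hV : ∀ v : V, p • v = 0)
    {Q : Subgroup (Equiv.Perm (ZMod 4 × V))} (hQ : IsPGroup p Q) (hQS : Q ≤ cayleyAut S)
    (hQ1 : ∀ q ∈ Q, ∀ g, (q g).1 = g.1) (hτ : ∀ u, sndTranslation u ∈ Q)
    (hST : IsCayleyIso S T b) (hb1 : ∀ g, (b g).1 = g.1) (hb0 : b 0 = 0)
    (hb : ∀ u, b * sndTranslation u * b⁻¹ ∈ Q) {v v' : V} {q : Equiv.Perm (ZMod 4 × V)}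
    (hq : q ∈ Q) (hq0 : q 0 = 0) (hqv : q (0, v) = b (0, v')) (d : ZMod 4) :
    T (d, v') ↔ S (d, v) := by
  have : Group.IsNilpotent Q := hQ.isNilpotent
  let c : ZMod 4 → V → V := fun i x => (b (i * d, x)).2
  have hc : ∀ i x, b (i * d, x) = (i * d, c i x) := fun i x => Prod.ext (hb1 _) rfl
  have hd : ∀ i : ZMod 4, ∀ x y : V, (d, y - x) = ((i + 1) * d, y) - (i * d, x) := by
    intro i x y
    rw [Prod.mk_sub_mk, add_mul, one_mul, add_sub_cancel_left]
  have H := levelAction_of_preserves_fst hQS hQ1 d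
  refine H.iso_apply (t := fun x => T (d, x)) hp hV (fun u => ⟨_, hτ (Multiplicative.ofAdd u)⟩)
    (fun i u x => ?_) c ?_ (fun u => ⟨_, hb (Multiplicative.ofAdd u)⟩) (fun i u x => ?_)
    (fun i x y => ?_) ?_ (q := ⟨q, hq⟩) ?_ ?_
  · simp only [sndTranslation_apply]
    exact PerEq.refl _ _
  · intro y
    refine ⟨(b.symm (0, y)).2, ?_⟩
    have h1 : (b.symm (0, y)).1 = 0 := by
      have := hb1 (b.symm (0, y))
      rwa [b.apply_symm_apply, eq_comm] at this
    have h2 : b.symm (0, y) = (0 * d, (b.symm (0, y)).2) := Prod.ext (by rw [h1, zero_mul]) rfl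
    change (b (0 * d, _)).2 = y
    rw [← h2, b.apply_symm_apply]
  · simp only [← hc, Equiv.Perm.mul_apply]
    rw [show (b⁻¹ : Equiv.Perm _) (b (i * d, x)) = _ from b.symm_apply_apply _,
      sndTranslation_apply]
    exact PerEq.refl _ _
  · rw [hd i, hd i, ← hc, ← hc]
    exact hST _ _
  · simp only [c, zero_mul]
    exact congrArg Prod.snd hb0
  · simp only [zero_mul]
    exact congrArg Prod.snd hq0
  · simp only [c, zero_mul]
    exact congrArg Prod.snd hqv

theorem exists_addEquiv_of_preserves_fst (hp : Odd p) (hcard : Nat.card V = p ^ 2)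
    (hV : ∀ v : V, p • v = 0) (hST : IsCayleyIso S T b) (hb1 : ∀ g, (b g).1 = g.1) :
    ∃ φ : V ≃+ V, ∀ d v, T (d, φ v) ↔ S (d, v) := by
  set L := fstStabilizer V with hL
  have hτL : ∀ u, sndTranslation (V := V) u ∈ L := fun u g => by
    rw [← ofAdd_toAdd u, sndTranslation_apply]
  have hbL : b ∈ L := hb1
  obtain ⟨Q, hQK, hQ, hQτ, a, ha, haQ⟩ := exists_pGroup_of_conj_mem (K := cayleyAut S ⊓ L) hV b
    (fun u => ⟨addRight_mem_cayleyAut S _, hτL u⟩)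
    (fun u => ⟨hST.conj_mem (addRight_mem_cayleyAut T _),
      L.mul_mem (L.mul_mem hbL (hτL u)) (L.inv_mem hbL)⟩)
  have habL : a * b ∈ L := mul_mem ha.2 hbL
  set g₀ := (a * b)⁻¹ 0 with hg₀
  have hg₀1 : g₀.1 = 0 := (inv_mem habL : (a * b)⁻¹ ∈ L) 0
  set t := Equiv.addRight g₀ with ht
  have htL : t ∈ L := fun g => by simp [ht, hg₀1]
  have hc0 : (a * b * t) 0 = 0 := by
    rw [Equiv.Perm.mul_apply, show t 0 = g₀ from zero_add g₀, hg₀]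
    exact (a * b).apply_symm_apply 0
  have hconj : ∀ u, a * b * t * sndTranslation u * (a * b * t)⁻¹ ∈ Q := by
    intro u
    rw [ht, mul_addRight_conj_sndTranslation]
    exact haQ u
  have hiso : IsCayleyIso S T (a * b * t) :=
    ((show IsCayleyIso S S a from ha.1).mul hST).mul (addRight_mem_cayleyAut T g₀)
  obtain ⟨φ, hφ⟩ := exists_addEquiv_of_preserves_zero hQ hcard hV
    (fun q hq v => (hQK hq).2 _) hQτ (fun v => mul_mem habL htL _) hc0 hconj
  refine ⟨φ, fun d v => ?_⟩
  obtain ⟨q, hq, hq0, hqv⟩ := hφ v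
  exact iff_of_preserves_fst hp hV hQ (fun x hx => (hQK hx).1) (fun q hq => (hQK hq).2) hQτ hiso
    (mul_mem habL htL) hc0 hconj hq hq0 hqv d

theorem exists_affine_of_perm (π : Equiv.Perm (ZMod 4)) : ∃ a c e : ZMod 4,
    (∀ i, π (π.symm (π i + c) + a) + e = i) ∨ (∀ i, π (π.symm (π i + c) + a) + e = -i) := by
  revert π
  decide +kernel

theorem exists_addEquiv_of_fst_eq (hp : Odd p) (hcard : Nat.card V = p ^ 2)
    (hV : ∀ v : V, p • v = 0) (hST : IsCayleyIso S T b) (π : Equiv.Perm (ZMod 4))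
    (hb1 : ∀ g, (b g).1 = π g.1) :
    ∃ ψ : ZMod 4 × V ≃+ ZMod 4 × V, ∀ g, T (ψ g) ↔ S g := by
  obtain ⟨a, c, e, h⟩ := exists_affine_of_perm π
  let t : ZMod 4 → Equiv.Perm (ZMod 4 × V) := fun i => Equiv.addRight (i, 0)
  let b' := t e * (b * t a * b⁻¹) * t c * b
  have ht : ∀ (U : ZMod 4 × V → Prop) i, t i ∈ cayleyAut U := fun U i =>
    addRight_mem_cayleyAut U _
  have hb' : IsCayleyIso S T b' :=
    (((show IsCayleyIso S S (t e) from ht S e).mul (hST.conj_mem (ht T a))).mul (ht S c)).mul hST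
  have hbs : ∀ g, (b.symm g).1 = π.symm g.1 := by
    intro g
    rw [Equiv.eq_symm_apply, ← hb1, b.apply_symm_apply]
  have hb'1 : ∀ g, (b' g).1 = π (π.symm (π g.1 + c) + a) + e := by
    intro g
    change (b (b.symm (b g + (c, 0)) + (a, 0)) + (e, 0)).1 = _
    rw [Prod.fst_add, hb1, Prod.fst_add, hbs, Prod.fst_add, hb1]
  rcases h with h | h
  · obtain ⟨φ, hφ⟩ := exists_addEquiv_of_preserves_fst hp hcard hV hb' fun g => by rw [hb'1, h]
    exact ⟨(AddEquiv.refl _).prodCongr φ, fun g => hφ g.1 g.2⟩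
  · let n : ZMod 4 × V ≃+ ZMod 4 × V := (AddEquiv.neg (ZMod 4)).prodCongr (AddEquiv.refl V)
    have hn : IsCayleyIso T (fun g => T (n g)) n.toEquiv := by
      intro g h
      simp only [map_sub]
      exact Iff.rfl
    obtain ⟨φ, hφ⟩ := exists_addEquiv_of_preserves_fst hp hcard hV (hb'.mul hn) fun g => by
      rw [Equiv.Perm.mul_apply, hb'1, h]
      exact neg_neg g.1
    exact ⟨(AddEquiv.neg _).prodCongr φ, fun g => hφ g.1 g.2⟩

end PreservesFst

/-- The permutation `(1 2 3)` of `ZMod 4`. -/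
def threeCycle : Equiv.Perm (ZMod 4) := Equiv.swap 1 2 * Equiv.swap 2 3

theorem eq_threeCycle_or (σ : Equiv.Perm (ZMod 4)) (h0 : σ 0 = 0) (h1 : σ ≠ 1) :
    σ = threeCycle ∨ σ⁻¹ = threeCycle ∨ σ * σ = 1 := by
  revert σ
  decide +kernel

section SplitOrbit

variable {V : Type*} [AddCommGroup V] [Finite V] {S : ZMod 4 × V → Prop}
  {Q : Subgroup (Equiv.Perm (ZMod 4 × V))}

theorem exists_fst_apply_eq_threeCycle (hQ : IsPGroup 3 Q) (hQ0 : ∀ q ∈ Q, ∀ v, (q (0, v)).1 = 0)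
    (hτ : ∀ u, sndTranslation u ∈ Q) (hne : ¬ Q ≤ fstStabilizer V) :
    ∃ y ∈ Q, ∀ i x, (y (i, x)).1 = threeCycle i := by
  have : Fact (Nat.Prime 3) := ⟨Nat.prime_three⟩
  have : Group.IsNilpotent Q := hQ.isNilpotent
  set Y : Subgroup Q := (fstStabilizer V).subgroupOf Q with hY
  have hYtop : Y < ⊤ := by
    rw [lt_top_iff_ne_top, Ne, hY, Subgroup.subgroupOf_eq_top]
    exact hne
  obtain ⟨y, hyN, hyY⟩ := SetLike.exists_of_lt
    (Group.normalizerCondition_of_isNilpotent Y hYtop)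
  set N := Subgroup.normalizer (Y : Set Q) with hN
  have hfst : ∀ z ∈ N, ∀ i x, (z.1 (i, x)).1 = (z.1 (i, 0)).1 := by
    intro z hz i x
    have h1 : (⟨_, hτ (Multiplicative.ofAdd x)⟩ : Q) ∈ Y := fun g => by
      change (sndTranslation (Multiplicative.ofAdd x) g).1 = g.1
      rw [sndTranslation_apply]
    have h2 := (Subgroup.mem_normalizer_iff.mp hz _).mp h1 (z.1 (i, 0))
    change (z.1 (sndTranslation (Multiplicative.ofAdd x) (z.1.symm (z.1 (i, 0))))).1 = _ at h2
    rwa [Equiv.symm_apply_apply, sndTranslation_apply, zero_add] at h2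
  let θ : N →* Equiv.Perm (ZMod 4) := MonoidHom.toHomPerm
    { toFun := fun z i => (z.1.1 (i, 0)).1
      map_one' := rfl
      map_mul' := by
        intro z z'
        funext i
        exact hfst z.1 z.2 _ _ }
  have hθ : ∀ z : N, ∀ i x, (z.1.1 (i, x)).1 = θ z i := fun z => hfst z.1 z.2
  set w : N := ⟨y, hyN⟩ with hw
  have h1 : θ w ≠ 1 := by
    intro h
    refine hyY fun g => ?_
    have := hθ w g.1 g.2
    rwa [h] at this
  rcases eq_threeCycle_or (θ w) (hQ0 _ y.2 0) h1 with h | h | h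
  · exact ⟨y.1, y.2, fun i x => by rw [← h]; exact hθ w i x⟩
  · exact ⟨(y⁻¹ : Q).1, (y⁻¹ : Q).2, fun i x => by rw [← h, ← map_inv]; exact hθ w⁻¹ i x⟩
  · exfalso
    obtain ⟨n, hn⟩ := hQ y
    have h3 : θ w ^ 3 ^ n = 1 := by
      rw [← map_pow, show w ^ 3 ^ n = 1 from Subtype.ext hn, map_one]
    obtain ⟨m, hm⟩ : Odd (3 ^ n) := Odd.pow (by decide)
    rw [hm, pow_succ, pow_mul, sq, h, one_pow, one_mul] at h3
    exact h1 h3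

end SplitOrbit

/-- Three predicates with the same periods which become translates of common ones in the way
prescribed by a three-cycle on the nonzero classes modulo four are all equal. -/
theorem eq_of_shift_relations {V : Type*} [AddCommGroup V] {p : ℕ} (hp : Odd p)
    (hV : ∀ v : V, p • v = 0) {s f : ZMod 4 → V → Prop} (m : ZMod 4 → V) (hm : m 0 = 0)
    (h2 : ∀ a b, PerEq (s 2) a b ↔ PerEq (s 1) a b)
    (h3 : ∀ a b, PerEq (s 3) a b ↔ PerEq (s 1) a b)
    (h : ∀ i j v, i ≠ j → (f (threeCycle j - threeCycle i) v ↔ s (j - i) (v - m j + m i))) (v : V) :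
    (s 2 v ↔ s 1 v) ∧ (s 3 v ↔ s 1 v) := by
  have h01 : ∀ v, f 2 v ↔ s 1 (v - m 1) := fun v => by
    have := h 0 1 v (by decide); rwa [hm, add_zero] at this
  have h02 : ∀ v, f 3 v ↔ s 2 (v - m 2) := fun v => by
    have := h 0 2 v (by decide); rwa [hm, add_zero] at this
  have h03 : ∀ v, f 1 v ↔ s 3 (v - m 3) := fun v => by
    have := h 0 3 v (by decide); rwa [hm, add_zero] at this
  have h10 : ∀ v, f 2 v ↔ s 3 (v + m 1) := fun v => by
    have := h 1 0 v (by decide); rwa [hm, sub_zero] at this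
  have h20 : ∀ v, f 1 v ↔ s 2 (v + m 2) := fun v => by
    have := h 2 0 v (by decide); rwa [hm, sub_zero] at this
  have h30 : ∀ v, f 3 v ↔ s 1 (v + m 3) := fun v => by
    have := h 3 0 v (by decide); rwa [hm, sub_zero] at this
  have h23 : ∀ v, f 2 v ↔ s 1 (v - m 3 + m 2) := fun v => h 2 3 v (by decide)
  have h21 : ∀ v, f 3 v ↔ s 3 (v - m 1 + m 2) := fun v => h 2 1 v (by decide)
  have hm3 : PerEq (s 1) (m 3) (m 1 + m 2) := by
    intro v
    have := (h01 (v + m 1 + m 3)).symm.trans (h23 _)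
    convert this using 2 <;> abel
  have h13 : ∀ v, s 1 v ↔ s 3 (v + 2 • m 1) := by
    intro v
    have := (h01 (v + m 1)).symm.trans (h10 _)
    convert this using 2 <;> abel
  have h13' : ∀ v, s 1 v ↔ s 3 (v - 2 • m 1) := by
    intro v
    have e1 := (h30 (v - m 3)).symm.trans (h21 _)
    have e2 := (h3 _ _).mpr hm3 (v - m 3 - 2 • m 1)
    have e3 : v - m 3 - m 1 + m 2 = m 1 + m 2 + (v - m 3 - 2 • m 1) := by abel
    have e4 : m 3 + (v - m 3 - 2 • m 1) = v - 2 • m 1 := by abel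
    rwa [sub_add_cancel, e3, ← e2, e4] at e1
  have hm1 : PerEq (s 1) (m 1) 0 := by
    refine PerEq.of_four_nsmul hp hV ((h3 _ _).mp fun v => ?_)
    have := (h13 (v + 2 • m 1)).symm.trans (h13' _)
    convert this using 2 <;> abel
  have h31 : ∀ v, s 3 v ↔ s 1 v := by
    intro v
    have e := (h3 _ _).mpr (hm1.nsmul 2) v
    rw [smul_zero, zero_add, add_comm] at e
    rw [h13, e]
  have hm32 : PerEq (s 1) (m 3) (m 2) := by
    have := hm1.add_right (m 2)
    rw [zero_add] at this
    exact hm3.trans this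
  have h12 : ∀ v, s 1 v ↔ s 2 (v - 2 • m 2) := by
    intro v
    have e1 := (h02 (v - m 2)).symm.trans (h30 _)
    have e2 := hm32 (v - m 2)
    rw [add_comm _ (m 3), e2, add_sub_cancel] at e1
    rw [← e1]
    congr! 1
    abel
  have h12' : ∀ v, s 1 v ↔ s 2 (v + 2 • m 2) := by
    intro v
    have e1 := (h03 (v + m 3)).symm.trans (h20 _)
    have e2 := (h2 _ _).mpr hm32 (v + m 2)
    rw [add_sub_cancel_right, h31, show v + m 3 + m 2 = m 3 + (v + m 2) by abel, e2] at e1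
    rw [e1]
    congr! 1
    abel
  have hm2 : PerEq (s 1) (m 2) 0 := by
    refine PerEq.of_four_nsmul hp hV ((h2 _ _).mp fun v => ?_)
    have := (h12' (v + 2 • m 2)).symm.trans (h12 _)
    convert this using 2 <;> abel
  refine ⟨?_, h31 v⟩
  have e := (h2 _ _).mpr (hm2.nsmul 2) v
  rw [smul_zero, zero_add, add_comm] at e
  rw [h12', e]

section ZeroFiber

variable {V : Type*} [Finite V] {b : Equiv.Perm (ZMod 4 × V)}

theorem snd_surjective (hb1 : ∀ v, (b (0, v)).1 = 0) :
    Function.Surjective fun v => (b (0, v)).2 := by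
  refine Finite.injective_iff_surjective.mp fun v w hvw => ?_
  exact congrArg Prod.snd (b.injective (Prod.ext ((hb1 v).trans (hb1 w).symm) hvw))

theorem fst_eq_zero_of_apply (hb1 : ∀ v, (b (0, v)).1 = 0) {g : ZMod 4 × V} (hg : (b g).1 = 0) :
    g.1 = 0 := by
  obtain ⟨v, hv⟩ := snd_surjective hb1 (b g).2
  have h : b (0, v) = b g := Prod.ext ((hb1 v).trans hg.symm) hv
  rw [← b.injective h]

end ZeroFiber

section SplitOrbitPredicates

variable {V : Type*} [AddCommGroup V] {S T : ZMod 4 × V → Prop} {b : Equiv.Perm (ZMod 4 × V)}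

theorem perEq_iff_sub {s : V → Prop} {x x' : V} :
    PerEq s x x' ↔ ∀ v, s (v - x) ↔ s (v - x') := by
  constructor
  · intro h v
    exact ((PerEq.refl s v).sub h).iff
  · intro h
    have h' : PerEq s (-x) (-x') := fun v => by
      rw [neg_add_eq_sub, neg_add_eq_sub]
      exact h v
    simpa using h'.neg

theorem perEq_iff_sub' {s : V → Prop} {x x' : V} :
    PerEq s x x' ↔ ∀ v, s (x - v) ↔ s (x' - v) := by
  constructor
  · intro h v
    exact (h.sub (PerEq.refl s v)).iff
  · intro h v
    have := h (-v)
    rwa [sub_neg_eq_add, sub_neg_eq_add] at this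

theorem perEq_iff_of_threeCycle {y : Equiv.Perm (ZMod 4 × V)} (hyS : y ∈ cayleyAut S)
    (hy : ∀ i x, (y (i, x)).1 = threeCycle i) (x x' : V) :
    (PerEq (fun v => S (2, v)) x x' ↔ PerEq (fun v => S (1, v)) x x') ∧
      (PerEq (fun v => S (3, v)) x x' ↔ PerEq (fun v => S (1, v)) x x') := by
  have hrel : ∀ i j x z, S (threeCycle j - threeCycle i, (y (j, z)).2 - (y (i, x)).2) ↔
      S (j - i, z - x) := by
    intro i j x z
    rw [← hy i x, ← hy j z]
    exact hyS _ _
  have hsurj : ∀ i, Function.Surjective fun x => (y (i, x)).2 := by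
    intro i z
    refine ⟨(y.symm (threeCycle i, z)).2, ?_⟩
    have h1 : (y.symm (threeCycle i, z)).1 = i := by
      apply threeCycle.injective
      rw [← hy _ (y.symm (threeCycle i, z)).2, Prod.mk.eta, y.apply_symm_apply]
    have h2 : (i, (y.symm (threeCycle i, z)).2) = y.symm (threeCycle i, z) := Prod.ext h1.symm rfl
    simp only [h2, y.apply_symm_apply]
  have hforward : ∀ d, PerEq (fun v => S (d - 0, v)) x x' ↔
      PerEq (fun v => S (threeCycle d - threeCycle 0, v)) (y (0, x)).2 (y (0, x')).2 := by
    intro d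
    rw [perEq_iff_sub, perEq_iff_sub]
    refine Iff.trans ?_ (hsurj d).forall.symm
    exact forall_congr' fun v => iff_congr (hrel 0 d x v).symm (hrel 0 d x' v).symm
  have hbackward : ∀ d, PerEq (fun v => S (0 - d, v)) x x' ↔
      PerEq (fun v => S (threeCycle 0 - threeCycle d, v)) (y (0, x)).2 (y (0, x')).2 := by
    intro d
    rw [perEq_iff_sub', perEq_iff_sub']
    refine Iff.trans ?_ (hsurj d).forall.symm
    exact forall_congr' fun v => iff_congr (hrel d 0 v x).symm (hrel d 0 v x').symm
  have f1 := hforward 1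
  have f3 := hforward 3
  have b1 := hbackward 1
  have b2 := hbackward 2
  rw [show (1 - 0 : ZMod 4) = 1 from rfl,
    show threeCycle 1 - threeCycle 0 = 2 by decide] at f1
  rw [show (3 - 0 : ZMod 4) = 3 from rfl,
    show threeCycle 3 - threeCycle 0 = 1 by decide] at f3
  rw [show (0 - 1 : ZMod 4) = 3 from rfl,
    show threeCycle 0 - threeCycle 1 = 2 by decide] at b1
  rw [show (0 - 2 : ZMod 4) = 2 from rfl,
    show threeCycle 0 - threeCycle 2 = 1 by decide] at b2
  have h31 := b1.trans f1.symm
  exact ⟨(b2.trans f3.symm).trans h31, h31⟩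

variable [Finite V]

theorem iff_one_of_splitOrbit (hV : ∀ v : V, 3 • v = 0) {Q : Subgroup (Equiv.Perm (ZMod 4 × V))}
    (hQ : IsPGroup 3 Q) (hQS : Q ≤ cayleyAut S) (hQ0 : ∀ q ∈ Q, ∀ v, (q (0, v)).1 = 0)
    (hτ : ∀ u, sndTranslation u ∈ Q) (hne : ¬ Q ≤ fstStabilizer V) (g : ZMod 4 × V)
    (hg : g.1 ≠ 0) : S g ↔ S (1, g.2) := by
  have : Fact (Nat.Prime 3) := ⟨Nat.prime_three⟩
  obtain ⟨y, hyQ, hy⟩ := exists_fst_apply_eq_threeCycle hQ hQ0 hτ hne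
  have hper := perEq_iff_of_threeCycle (hQS hyQ) hy
  have hya : ∀ i x, y (i, x) = (threeCycle i, (y (i, x)).2) := fun i x => Prod.ext (hy i x) rfl
  have hm : ∀ i, ∃ m, y (0, m) = (0, (y (i, 0)).2) := by
    intro i
    refine ⟨(y.symm (0, (y (i, 0)).2)).2, ?_⟩
    rw [← y.eq_symm_apply]
    refine Prod.ext ?_ rfl
    exact (hQ0 _ (inv_mem hyQ) _).symm
  choose m hm using hm
  have hm0 : m 0 = 0 := by
    have h1 : y (0, m 0) = y (0, 0) := by
      rw [hm, hya 0 0]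
      rfl
    exact congrArg Prod.snd (y.injective h1)
  have hshift : ∀ i u, PerEq (fun v => S (1, v)) (y (i, u)).2 (y (0, m i + u)).2 := by
    intro i u
    set Y := Q ⊓ fstStabilizer V with hY
    have hYp : IsPGroup 3 Y := hQ.to_le inf_le_left
    have : Group.IsNilpotent Y := hYp.isNilpotent
    have hτY : ∀ u, sndTranslation u ∈ Y := fun u => ⟨hτ u, fun g => by
      rw [← ofAdd_toAdd u, sndTranslation_apply]⟩
    set q := y * sndTranslation (Multiplicative.ofAdd u) * y⁻¹ with hq
    have hqy : ∀ i x, q (y (i, x)) = y (i, x + u) := by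
      intro i x
      rw [hq, Equiv.Perm.mul_apply, Equiv.Perm.mul_apply,
        show (y⁻¹ : Equiv.Perm _) (y (i, x)) = _ from y.symm_apply_apply _, sndTranslation_apply]
    have hqY : q ∈ Y := by
      refine ⟨Q.mul_mem (Q.mul_mem hyQ (hτ _)) (Q.inv_mem hyQ), fun g => ?_⟩
      obtain ⟨⟨i, x⟩, rfl⟩ := y.surjective g
      rw [hqy, hy, hy]
    have H := levelAction_of_preserves_fst (S := S) (Q := Y) (inf_le_left.trans hQS)
      (fun q hq => hq.2) 1
    have h1 := H.level_zero (p := 3) (by decide) hV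
      (fun u => ⟨_, hτY (Multiplicative.ofAdd u)⟩)
      (fun i u x => by simp only [sndTranslation_apply]; exact PerEq.refl _ _)
      (threeCycle i) ⟨q, hqY⟩ (y (i, 0)).2
    simp only [mul_one] at h1
    rwa [← hya, ← hm, hqy, hqy, zero_add] at h1
  have hd : ∀ d : ZMod 4, d ≠ 0 → ∀ x x', PerEq (fun v => S (1, v)) x x' →
      PerEq (fun v => S (d, v)) x x' := by
    intro d hd x x' h
    obtain rfl | rfl | rfl : d = 1 ∨ d = 2 ∨ d = 3 := by revert d; decide
    · exact h
    · exact (hper x x').1.mpr h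
    · exact (hper x x').2.mpr h
  have hfin := eq_of_shift_relations (p := 3) (by decide) hV (s := fun d v => S (d, v))
    (f := fun d v => S (d, (y (0, v)).2 - (y (0, 0)).2)) m hm0 (fun x x' => (hper x x').1)
    (fun x x' => (hper x x').2) (by
      intro i j v hij
      have hne : threeCycle j - threeCycle i ≠ 0 :=
        sub_ne_zero.mpr fun h => hij (threeCycle.injective h).symm
      have e1 := hd _ hne _ _ (hshift j (v - m j))
      have e2 := hd _ hne _ _ (hshift i (-m i))
      have e3 := (e1.sub e2).iff
      rw [add_sub_cancel, add_neg_cancel] at e3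
      rw [← e3, ← hy i (-m i), ← hy j (v - m j)]
      refine (hQS hyQ _ _).trans ?_
      rw [Prod.mk_sub_mk, sub_neg_eq_add])
  obtain ⟨d, v⟩ := g
  change d ≠ 0 at hg
  change S (d, v) ↔ S (1, v)
  obtain rfl | rfl | rfl : d = 1 ∨ d = 2 ∨ d = 3 := by revert d; decide
  · exact Iff.rfl
  · exact (hfin v).1
  · exact (hfin v).2

theorem snd_sub_iff (hS : ∀ g, g.1 ≠ 0 → (S g ↔ S (1, g.2)))
    (hT : ∀ g, g.1 ≠ 0 → (T g ↔ T (1, g.2))) (hST : IsCayleyIso S T b)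
    (hb1 : ∀ v, (b (0, v)).1 = 0) {g h : ZMod 4 × V} (hgh : (g.1 = 0) ↔ ¬ (h.1 = 0)) :
    S (1, (b h).2 - (b g).2) ↔ T (1, h.2 - g.2) := by
  have hb : ∀ g, (b g).1 = 0 ↔ g.1 = 0 := by
    intro g
    refine ⟨fst_eq_zero_of_apply hb1, fun h => ?_⟩
    have := hb1 g.2
    rwa [show (0, g.2) = g from Prod.ext h.symm rfl] at this
  have h1 : ∀ x y : ZMod 4, ((x = 0) ↔ ¬ (y = 0)) → y - x ≠ 0 := by decide
  have h2 := hS (b h - b g) (h1 _ _ (by rwa [hb, hb]))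
  have h3 := hT (h - g) (h1 _ _ hgh)
  exact h2.symm.trans ((hST g h).trans h3)

theorem perEq_snd_apply (hS : ∀ g, g.1 ≠ 0 → (S g ↔ S (1, g.2)))
    (hT : ∀ g, g.1 ≠ 0 → (T g ↔ T (1, g.2))) (hST : IsCayleyIso S T b)
    (hb1 : ∀ v, (b (0, v)).1 = 0) {i j : ZMod 4} (hij : i = 0 ↔ j = 0) (x : V) :
    PerEq (fun v => S (1, v)) (b (i, x)).2 (b (j, x)).2 := by
  by_cases hi : i = 0
  · rw [hi, hij.mp hi]
    exact PerEq.refl _ _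
  · have hj : j ≠ 0 := fun h => hi (hij.mpr h)
    rw [perEq_iff_sub', (snd_surjective hb1).forall]
    intro v
    rw [snd_sub_iff hS hT hST hb1 (by simp [hi]), snd_sub_iff hS hT hST hb1 (by simp [hj])]

theorem iff_of_splitOrbit {p : ℕ} [Fact p.Prime] (hp : Odd p) (hV : ∀ v : V, p • v = 0)
    {Q : Subgroup (Equiv.Perm (ZMod 4 × V))} (hQ : IsPGroup p Q) (hQS : Q ≤ cayleyAut S)
    (hQ0 : ∀ q ∈ Q, ∀ v, (q (0, v)).1 = 0) (hτ : ∀ u, sndTranslation u ∈ Q)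
    (hS : ∀ g, g.1 ≠ 0 → (S g ↔ S (1, g.2))) (hT : ∀ g, g.1 ≠ 0 → (T g ↔ T (1, g.2)))
    (hST : IsCayleyIso S T b) (hb1 : ∀ v, (b (0, v)).1 = 0) (hb0 : b 0 = 0)
    (hb : ∀ u, b * sndTranslation u * b⁻¹ ∈ Q) {v v' : V} {q : Equiv.Perm (ZMod 4 × V)}
    (hq : q ∈ Q) (hq0 : q 0 = 0) (hqv : q (0, v) = b (0, v')) (d : ZMod 4) :
    T (d, v') ↔ S (d, v) := by
  by_cases hd : d = 0
  · subst hd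
    have h1 := hST 0 (0, v')
    have h2 := hQS hq 0 (0, v)
    rw [hb0, ← hqv, sub_zero, sub_zero] at h1
    rw [hq0, sub_zero, sub_zero] at h2
    exact h1.symm.trans h2
  rw [hT (d, v') hd, hS (d, v) hd]
  have : Group.IsNilpotent Q := hQ.isNilpotent
  have hpar : ∀ i : ZMod 4, (2 * i = 0) ↔ ¬ (2 * (i + 1) = 0) := by decide
  have hcomp : ∀ q ∈ Q, ∀ {a : Equiv.Perm (ZMod 4 × V)}, (∀ v, (a (0, v)).1 = 0) → ∀ i x,
      PerEq (fun v => S (1, v)) (q (a (i, x))).2 (q (i, (a (i, x)).2)).2 := by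
    intro q hq a ha i x
    refine perEq_snd_apply (i := (a (i, x)).1) hS hS (hQS hq) (hQ0 q hq)
      ⟨fun h => ?_, fun h => ?_⟩ _
    · exact fst_eq_zero_of_apply ha h
    · subst h
      exact ha x
  have H : LevelAction (fun x => S (1, x)) fun i (q : Q) x => (q.1 (2 * i, x)).2 :=
    { mul := fun i q q' x => hcomp q.1 q.2 (hQ0 q'.1 q'.2) _ _
      one := fun i x => PerEq.refl _ _
      rel := fun i q x y => snd_sub_iff hS hS (hQS q.2) (hQ0 q.1 q.2) (hpar i) }
  refine H.iso_apply (t := fun x => T (1, x)) hp hV (fun u => ⟨_, hτ (Multiplicative.ofAdd u)⟩)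
    (fun i u x => ?_) (fun i x => (b (2 * i, x)).2) ?_
    (fun u => ⟨_, hb (Multiplicative.ofAdd u)⟩) (fun i u x => ?_)
    (fun i x y => snd_sub_iff hS hT hST hb1 (hpar i)) ?_ (q := ⟨q, hq⟩) ?_ ?_
  · simp only [sndTranslation_apply]
    exact PerEq.refl _ _
  · simp only [mul_zero]
    exact snd_surjective hb1
  · have h1 := hcomp _ (hb (Multiplicative.ofAdd u)) hb1 (2 * i) x
    have h2 : (b * sndTranslation (Multiplicative.ofAdd u) * b⁻¹) (b (2 * i, x)) =
        b (2 * i, x + u) := by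
      rw [Equiv.Perm.mul_apply, Equiv.Perm.mul_apply,
        show (b⁻¹ : Equiv.Perm _) (b (2 * i, x)) = _ from b.symm_apply_apply _,
        sndTranslation_apply]
    rw [h2] at h1
    exact h1.symm
  · simp only [mul_zero]
    exact congrArg Prod.snd hb0
  · simp only [mul_zero]
    exact congrArg Prod.snd hq0
  · simp only [mul_zero]
    exact congrArg Prod.snd hqv

theorem exists_addEquiv_of_splitOrbit (hcard : Nat.card V = 3 ^ 2) (hV : ∀ v : V, 3 • v = 0)
    {Q : Subgroup (Equiv.Perm (ZMod 4 × V))} (hQ : IsPGroup 3 Q) (hQS : Q ≤ cayleyAut S)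
    (hQ0 : ∀ q ∈ Q, ∀ v, (q (0, v)).1 = 0) (hτ : ∀ u, sndTranslation u ∈ Q)
    (hne : ¬ Q ≤ fstStabilizer V) (hST : IsCayleyIso S T b) (hb0 : b 0 = 0)
    (hb : ∀ u, b * sndTranslation u * b⁻¹ ∈ Q) :
    ∃ ψ : ZMod 4 × V ≃+ ZMod 4 × V, ∀ g, T (ψ g) ↔ S g := by
  have : Fact (Nat.Prime 3) := ⟨Nat.prime_three⟩
  have hb1 : ∀ v, (b (0, v)).1 = 0 := by
    intro v
    have h := hQ0 _ (hb (Multiplicative.ofAdd v)) 0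
    rw [← Prod.zero_eq_mk, ← hb0, Equiv.Perm.mul_apply, Equiv.Perm.mul_apply,
      show (b⁻¹ : Equiv.Perm _) (b 0) = _ from b.symm_apply_apply _, sndTranslation_apply] at h
    simpa using h
  have hb1' : ∀ v, (b⁻¹ (0, v)).1 = 0 := fun v =>
    fst_eq_zero_of_apply hb1 (congrArg Prod.fst (b.apply_symm_apply (0, v)))
  have h0 : ∀ {a : Equiv.Perm (ZMod 4 × V)}, (∀ v, (a (0, v)).1 = 0) → ∀ g, g.1 = 0 →
      (a g).1 = 0 := by
    rintro a ha ⟨i, v⟩ rfl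
    exact ha v
  set R : Subgroup (Equiv.Perm (ZMod 4 × V)) := Q.map (MulAut.conj b⁻¹).toMonoidHom with hR
  have hτR : ∀ u, sndTranslation u ∈ R := fun u => ⟨_, hb u, by simp [mul_assoc]⟩
  have hneR : ¬ R ≤ fstStabilizer V := by
    intro hRL
    obtain ⟨y, hyQ, hy⟩ := exists_fst_apply_eq_threeCycle hQ hQ0 hτ hne
    have hfst : ∀ q ∈ Q, ∀ g, (b.symm (q (b g))).1 = g.1 := fun q hq g =>
      hRL (x := b⁻¹ * q * b⁻¹⁻¹) ⟨q, hq, rfl⟩ g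
    have htrans : ∀ q ∈ Q, ∀ g h : ZMod 4 × V, (q (b g)).1 = (b h).1 → g.1 = h.1 := by
      intro q hq g h hgh
      rw [← hfst _ (Q.mul_mem (hτ (Multiplicative.ofAdd ((b h).2 - (q (b g)).2))) hq) g,
        Equiv.Perm.mul_apply, sndTranslation_apply, add_sub_cancel, hgh, Prod.mk.eta,
        b.symm_apply_apply]
    have hy' : ∀ g, (y g).1 = threeCycle g.1 := fun g => hy g.1 g.2
    have hcycle : ∀ i j : ZMod 4, i ≠ 0 → j ≠ 0 →
        i = j ∨ threeCycle i = j ∨ threeCycle (threeCycle i) = j := by decide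
    have h12 : ((1 : ZMod 4), (0 : V)).1 = ((2 : ZMod 4), (0 : V)).1 := by
      rcases hcycle (b (1, 0)).1 (b (2, 0)).1
        (fun h => absurd (fst_eq_zero_of_apply hb1 h) (show (1 : ZMod 4) ≠ 0 by decide))
        (fun h => absurd (fst_eq_zero_of_apply hb1 h) (show (2 : ZMod 4) ≠ 0 by decide))
        with h | h | h
      · exact htrans 1 Q.one_mem _ _ h
      · exact htrans y hyQ _ _ ((hy' _).trans h)
      · refine htrans (y * y) (Q.mul_mem hyQ hyQ) _ _ ?_
        rw [Equiv.Perm.mul_apply, hy', hy', h]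
    exact absurd h12 (show (1 : ZMod 4) ≠ 2 by decide)
  have hS := iff_one_of_splitOrbit hV hQ hQS hQ0 hτ hne
  have hT := iff_one_of_splitOrbit (S := T) hV (hQ.map _) (Q := R)
    (by
      rintro _ ⟨q, hq, rfl⟩
      exact hST.inv.conj_mem (hQS hq))
    (by
      rintro _ ⟨q, hq, rfl⟩ v
      exact h0 hb1' _ (h0 (hQ0 q hq) _ (hb1 v))) hτR hneR
  obtain ⟨φ, hφ⟩ := exists_addEquiv_of_preserves_zero hQ hcard hV hQ0 hτ hb1 hb0 hb
  refine ⟨(AddEquiv.refl _).prodCongr φ, fun g => ?_⟩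
  obtain ⟨q, hq, hq0, hqv⟩ := hφ g.2
  exact iff_of_splitOrbit (by decide) hV hQ hQS hQ0 hτ hS hT hST hb1 hb0 hb hq hq0 hqv g.1

/-- The case of an invariant coset which need not be the zero coset. -/
theorem exists_addEquiv_of_splitOrbit_coset (hcard : Nat.card V = 3 ^ 2)
    (hV : ∀ v : V, 3 • v = 0) {Q : Subgroup (Equiv.Perm (ZMod 4 × V))} (hQ : IsPGroup 3 Q)
    (hQS : Q ≤ cayleyAut S) (j : ZMod 4) (hQj : ∀ q ∈ Q, ∀ v, (q (j, v)).1 = j)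
    (hτ : ∀ u, sndTranslation u ∈ Q) (hne : ¬ Q ≤ fstStabilizer V) (hST : IsCayleyIso S T b)
    (hb : ∀ u, b * sndTranslation u * b⁻¹ ∈ Q) :
    ∃ ψ : ZMod 4 × V ≃+ ZMod 4 × V, ∀ g, T (ψ g) ↔ S g := by
  set t : Equiv.Perm (ZMod 4 × V) := Equiv.addRight (j, 0) with ht
  have ht1 : ∀ g, (t g).1 = g.1 + j := fun g => rfl
  have htτ : ∀ u, t⁻¹ * sndTranslation u * t⁻¹⁻¹ = sndTranslation u := by
    intro u
    have h := mul_addRight_conj_sndTranslation 1 ((j, 0) : ZMod 4 × V) u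
    rw [one_mul, ← ht, one_mul, inv_one, mul_one] at h
    nth_rewrite 1 [← h]
    group
  have htS : t ∈ cayleyAut S := addRight_mem_cayleyAut S _
  refine exists_addEquiv_of_splitOrbit (S := S) (T := T) (Q := Q.map (MulAut.conj t⁻¹).toMonoidHom)
    (b := t⁻¹ * b * Equiv.addRight (b⁻¹ (j, 0))) hcard hV (hQ.map _) ?_ ?_ ?_ ?_
    ((show IsCayleyIso S S t⁻¹ from inv_mem htS).mul hST |>.mul (addRight_mem_cayleyAut T _)) ?_ ?_
  · rintro _ ⟨q, hq, rfl⟩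
    exact mul_mem (mul_mem (inv_mem htS) (hQS hq)) (inv_mem (inv_mem htS))
  · rintro _ ⟨q, hq, rfl⟩ v
    have h := ht1 (t⁻¹ (q (t (0, v))))
    rw [show t (t⁻¹ (q (t (0, v)))) = q (t (0, v)) from t.apply_symm_apply _,
      show t (0, v) = (j, v) by simp [ht], hQj q hq, right_eq_add] at h
    have ht' : t (0, v) = (j, v) := by simp [ht]
    change (t⁻¹ (q (t (0, v)))).1 = 0
    rw [ht', h]
  · exact fun u => ⟨_, hτ u, htτ u⟩
  · intro hL
    apply hne
    intro q hq g
    have h := hL (x := t⁻¹ * q * t⁻¹⁻¹) ⟨q, hq, rfl⟩ (t.symm g)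
    have h2 : t (t.symm g) = g := t.apply_symm_apply g
    have h3 : (t⁻¹ * q * t⁻¹⁻¹) (t.symm g) = t.symm (q g) := by
      rw [inv_inv, Equiv.Perm.mul_apply, h2]
      rfl
    rw [h3] at h
    have h4 := ht1 (t.symm (q g))
    rw [h, ← ht1, h2, t.apply_symm_apply] at h4
    exact h4
  · rw [Equiv.Perm.mul_apply, show Equiv.addRight (b⁻¹ (j, 0)) 0 = b⁻¹ (j, 0) from zero_add _,
      Equiv.Perm.mul_apply, show b (b⁻¹ (j, 0)) = (j, 0) from b.apply_symm_apply _]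
    change t.symm (j, 0) = 0
    rw [Equiv.symm_apply_eq]
    simp [ht]
  · intro u
    rw [mul_addRight_conj_sndTranslation]
    exact ⟨_, hb u, by simp [mul_assoc]⟩

end SplitOrbitPredicates

section Dichotomy

variable {V : Type*} [AddCommGroup V] [Finite V] {p : ℕ} [Fact p.Prime]

theorem le_fstStabilizer_or_exists_invariant (hp : Odd p) (hcard : Nat.card V = p ^ 2)
    {Q : Subgroup (Equiv.Perm (ZMod 4 × V))} (hQ : IsPGroup p Q)
    (hτ : ∀ u, sndTranslation u ∈ Q) :
    Q ≤ fstStabilizer V ∨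
      p = 3 ∧ ¬ Q ≤ fstStabilizer V ∧ ∃ j : ZMod 4, ∀ q ∈ Q, ∀ v, (q (j, v)).1 = j := by
  by_cases hL : Q ≤ fstStabilizer V
  · exact Or.inl hL
  refine Or.inr ?_
  have hprime : p.Prime := Fact.out
  obtain ⟨q, hq, g, hg⟩ : ∃ q ∈ Q, ∃ g, (q g).1 ≠ g.1 := by
    by_contra! h
    exact hL h
  set C : Set (ZMod 4) := Prod.fst '' MulAction.orbit Q g with hC
  have horbit : MulAction.orbit Q g = C ×ˢ (Set.univ : Set V) := by
    ext ⟨i, v⟩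
    rw [Set.mem_prod]
    refine ⟨fun h => ⟨⟨_, h, rfl⟩, trivial⟩, ?_⟩
    rintro ⟨⟨⟨i', w⟩, ⟨r, hr⟩, h⟩, -⟩
    obtain rfl : i' = i := h
    refine ⟨⟨_, Q.mul_mem (hτ (Multiplicative.ofAdd (v - w))) r.2⟩, ?_⟩
    change sndTranslation _ (r.1 g) = _
    rw [show r.1 g = (i', w) from hr, sndTranslation_apply, add_sub_cancel]
  obtain ⟨n, hn⟩ := hQ.card_orbit g
  rw [Nat.card_coe_set_eq, horbit, Set.ncard_prod, Set.ncard_univ, hcard] at hn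
  obtain ⟨k, -, hk⟩ := (Nat.dvd_prime_pow hprime).mp ⟨_, hn.symm⟩
  have hC4 : C.ncard ≤ 4 := by
    simpa using Set.ncard_le_card C
  have hC1 : 1 < C.ncard := (Set.one_lt_ncard).mpr
    ⟨_, ⟨_, ⟨⟨q, hq⟩, rfl⟩, rfl⟩, _, ⟨_, MulAction.mem_orbit_self g, rfl⟩, hg⟩
  have hp3 : 3 ≤ p := by
    have := hprime.two_le
    obtain ⟨m, hm⟩ := hp
    omega
  obtain rfl : k = 1 := by
    rcases k with _ | _ | k
    · rw [hk] at hC1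
      simp at hC1
    · rfl
    · have h1 : 3 ^ 2 ≤ p ^ (k + 1 + 1) :=
        (Nat.pow_le_pow_left hp3 2).trans (Nat.pow_le_pow_right (by omega) (by omega))
      omega
  rw [pow_one] at hk
  obtain rfl : p = 3 := by
    obtain ⟨m, hm⟩ := hp
    omega
  obtain ⟨j, hj⟩ : ∃ j, Cᶜ = {j} := by
    rw [← Set.ncard_eq_one]
    have := Set.ncard_add_ncard_compl C
    rw [Nat.card_zmod] at this
    omega
  have hjC : ∀ i, i ∉ C ↔ i = j := fun i => by
    rw [← Set.mem_compl_iff, hj, Set.mem_singleton_iff]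
  refine ⟨rfl, hL, j, fun r hr v => (hjC _).mp fun h => (hjC j).mpr rfl ?_⟩
  have hmem : r (j, v) ∈ MulAction.orbit Q g := by
    rw [horbit]
    exact ⟨h, trivial⟩
  have hmem' : (j, v) ∈ MulAction.orbit Q g := by
    rw [← MulAction.orbit_eq_iff] at hmem ⊢
    rw [← hmem]
    exact (MulAction.orbit_smul (⟨r, hr⟩ : Q) (j, v)).symm
  exact ⟨_, hmem', rfl⟩

theorem exists_addEquiv_of_isCayleyIso (hp : Odd p) (hcard : Nat.card V = p ^ 2)
    (hV : ∀ v : V, p • v = 0) {S T : ZMod 4 × V → Prop} {b : Equiv.Perm (ZMod 4 × V)}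
    (hST : IsCayleyIso S T b) :
    ∃ ψ : ZMod 4 × V ≃+ ZMod 4 × V, ∀ g, T (ψ g) ↔ S g := by
  obtain ⟨Q, hQS, hQ, hτ, a, ha, haQ⟩ := exists_pGroup_of_conj_mem (K := cayleyAut S) hV b
    (fun u => addRight_mem_cayleyAut S _) fun u => hST.conj_mem (addRight_mem_cayleyAut T _)
  have hab : IsCayleyIso S T (a * b) := (show IsCayleyIso S S a from ha).mul hST
  rcases le_fstStabilizer_or_exists_invariant hp hcard hQ hτ with hL | ⟨rfl, hL, j, hj⟩
  · have hfst : ∀ g, ((a * b) g).1 = ((a * b) (g.1, 0)).1 := by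
      rintro ⟨i, v⟩
      have h := hL (haQ (Multiplicative.ofAdd v)) ((a * b) (i, 0))
      rw [Equiv.Perm.mul_apply, Equiv.Perm.mul_apply (a * b),
        show (a * b)⁻¹ ((a * b) (i, 0)) = _ from (a * b).symm_apply_apply _,
        sndTranslation_apply, zero_add] at h
      exact h
    have hsurj : Function.Surjective fun i => ((a * b) (i, 0)).1 := by
      intro i
      refine ⟨((a * b).symm (i, 0)).1, ?_⟩
      dsimp only
      rw [← hfst, (a * b).apply_symm_apply]
    exact exists_addEquiv_of_fst_eq hp hcard hV hab
      (Equiv.ofBijective _ hsurj.bijective_of_finite) hfst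
  · exact exists_addEquiv_of_splitOrbit_coset hcard hV hQ hQS j hj hτ hL hab haQ

end Dichotomy

/-- Let `p` be an odd prime. Then `C₄ × C_p × C_p` is a DCI-group:
for all subsets `S, T`, any digraph isomorphism between `Cay(G,S)` and `Cay(G,T)`
implies that they are Cayley isomorphic. -/
theorem stmt1 (p : ℕ) (hp : p.Prime) (hodd : Odd p)
    (S T : Set (Multiplicative (ZMod 4) × Multiplicative (ZMod p) × Multiplicative (ZMod p)))
    (hiso : ∃ f : (Multiplicative (ZMod 4) × Multiplicative (ZMod p) × Multiplicative (ZMod p)) ≃ (Multiplicative (ZMod 4) × Multiplicative (ZMod p) × Multiplicative (ZMod p)),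
      ∀ g h, h * g⁻¹ ∈ S ↔ f h * (f g)⁻¹ ∈ T) :
    ∃ φ : (Multiplicative (ZMod 4) × Multiplicative (ZMod p) × Multiplicative (ZMod p)) ≃* (Multiplicative (ZMod 4) × Multiplicative (ZMod p) × Multiplicative (ZMod p)), ⇑φ '' S = T := by
  have : Fact p.Prime := ⟨hp⟩
  obtain ⟨f, hf⟩ := hiso
  let c : ZMod 4 × ZMod p × ZMod p ≃
      Multiplicative (ZMod 4) × Multiplicative (ZMod p) × Multiplicative (ZMod p) :=
    Multiplicative.ofAdd.prodCongr (Multiplicative.ofAdd.prodCongr Multiplicative.ofAdd)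
  have hsub : ∀ g h, c (h - g) = c h * (c g)⁻¹ := fun g h => by
    rw [← div_eq_mul_inv]
    rfl
  obtain ⟨ψ, hψ⟩ := exists_addEquiv_of_isCayleyIso (V := ZMod p × ZMod p) (p := p) hodd
    (by rw [Nat.card_prod, Nat.card_zmod, sq]) (fun v => by simp [Prod.ext_iff])
    (S := fun g => c g ∈ S) (T := fun g => c g ∈ T) (b := (c.trans f.symm).trans c.symm)
    (fun g h => by
      dsimp only
      rw [hsub, hsub, hf]
      simp only [Equiv.trans_apply, Equiv.apply_symm_apply])
  have hadd : ∀ x y, c.symm (x * y) = c.symm x + c.symm y := fun _ _ => rfl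
  have hmul : ∀ g h, c (g + h) = c g * c h := fun _ _ => rfl
  refine ⟨MulEquiv.mk' ((c.symm.trans ψ.toEquiv).trans c) fun x y => ?_, ?_⟩
  · change c (ψ (c.symm (x * y))) = c (ψ (c.symm x)) * c (ψ (c.symm y))
    rw [hadd, map_add, hmul]
  · change (fun x => c (ψ (c.symm x))) '' S = T
    ext z
    constructor
    · rintro ⟨x, hx, rfl⟩
      refine (hψ _).mpr ?_
      rwa [c.apply_symm_apply]
    · intro hz
      refine ⟨c (ψ.symm (c.symm z)), (hψ _).mp ?_, ?_⟩
      · rwa [ψ.apply_symm_apply, c.apply_symm_apply]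
      · dsimp only
        rw [c.symm_apply_apply, ψ.apply_symm_apply, c.apply_symm_apply]

end Paper
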